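/- arXiv:2205.01660 — 4 statements merged into one kernel-verified Lean document; each statement's English description precedes it below -/
import Mathlib

section
/- Let k be a commutative Noetherian ring, A an associative unital k-algebra that is finitely generated as a k-module, and n > 1 an integer. If D and D' are [1,n)-integrable k-derivations on A, then the commutator [D,D'] = D∘D' − D'∘D is [1,n)-integrable; moreover, if k is a field of characteristic p > 0, then for any [1,n)-integrable derivation D the p-fold composite D^p is also [1,n)-integrable. Thus Der_{[1,n)}(A) is a Lie subalgebra (and, in characteristic p, a restricted Lie subalgebra) of Der(A). -/
/-- A `k`-derivation on an associative unital `k`-algebra `A`: a `k`-linear map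
satisfying the Leibniz rule. -/
def IsDerivation (k A : Type*) [CommRing k] [Ring A] [Algebra k A]
    (D : A →ₗ[k] A) : Prop :=
  ∀ x y : A, D (x * y) = D x * y + x * D y

/-- `D` is `[m,n)`-integrable: there is a family `α_0 = id, α_1, …, α_{n-1}` of
`k`-linear endomorphisms of `A` with `α_i = 0` for `0 < i < m`, `α_m = D`, and
satisfying the Hasse–Schmidt convolution identities for all `i < n`. -/
def IsFinIntegrable (k A : Type*) [CommRing k] [Ring A] [Algebra k A]
    (m n : ℕ) (D : A →ₗ[k] A) : Prop :=
  ∃ α : ℕ → (A →ₗ[k] A),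
    α 0 = LinearMap.id ∧
    (∀ i, 0 < i → i < m → α i = 0) ∧
    α m = D ∧
    ∀ i, i < n → ∀ x y : A,
      α i (x * y) = ∑ j ∈ Finset.range (i + 1), α j x * α (i - j) y

/-- `D` is `[m,∞]`-integrable: an infinite Hasse–Schmidt family exists
(equivalently, an automorphism of `A⟦t⟧` congruent to `1` mod `t^m` with
`t^m`-coefficient `D`). -/
def IsInfIntegrable (k A : Type*) [CommRing k] [Ring A] [Algebra k A]
    (m : ℕ) (D : A →ₗ[k] A) : Prop :=
  ∃ α : ℕ → (A →ₗ[k] A),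
    α 0 = LinearMap.id ∧
    (∀ i, 0 < i → i < m → α i = 0) ∧
    α m = D ∧
    ∀ i, ∀ x y : A,
      α i (x * y) = ∑ j ∈ Finset.range (i + 1), α j x * α (i - j) y

namespace HasseSchmidt

open MvPowerSeries
open Finset.HasAntidiagonal (antidiagonal mem_antidiagonal)

variable {k A ι : Type*} [CommRing k] [Ring A] [Algebra k A]

/-- Formal power series of `k`-linear endomorphisms of `A`. -/
abbrev EndSeries (k A ι : Type*) [CommRing k] [Ring A] [Algebra k A] : Type _ :=
  MvPowerSeries ι (Module.End k A)

/-- All exponents with nonzero coefficient in `f` lie in `X`. -/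
def SuppIn (X : Set (ι →₀ ℕ)) (f : EndSeries k A ι) : Prop :=
  ∀ v, v ∉ X → coeff v f = 0

theorem SuppIn.mono {X Y : Set (ι →₀ ℕ)} {f : EndSeries k A ι} (hf : SuppIn X f) (h : X ⊆ Y) :
    SuppIn Y f :=
  fun v hv => hf v fun hX => hv (h hX)

theorem SuppIn.add {X : Set (ι →₀ ℕ)} {f g : EndSeries k A ι} (hf : SuppIn X f)
    (hg : SuppIn X g) : SuppIn X (f + g) :=
  fun v hv => by rw [map_add, hf v hv, hg v hv, add_zero]

theorem SuppIn.sub {X : Set (ι →₀ ℕ)} {f g : EndSeries k A ι} (hf : SuppIn X f)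
    (hg : SuppIn X g) : SuppIn X (f - g) :=
  fun v hv => by rw [map_sub, hf v hv, hg v hv, sub_zero]

/-- Every series with constant coefficient `1` is a unit. -/
theorem exists_unit (f : EndSeries k A ι) (hf : coeff 0 f = 1) :
    ∃ u : (EndSeries k A ι)ˣ, (u : EndSeries k A ι) = f := by
  obtain ⟨u, hu⟩ : IsUnit f := by
    rw [isUnit_iff_constantCoeff, ← coeff_zero_eq_constantCoeff_apply, hf]
    exact isUnit_one
  exact ⟨u, hu⟩

/-- Agreement of the coefficients with exponents in `Δ`. -/
def Agree (Δ : LowerSet (ι →₀ ℕ)) (f g : EndSeries k A ι) : Prop :=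
  ∀ v ∈ Δ, coeff v f = coeff v g

theorem Agree.refl (Δ : LowerSet (ι →₀ ℕ)) (f : EndSeries k A ι) : Agree Δ f f :=
  fun _ _ => rfl

theorem Agree.symm {Δ : LowerSet (ι →₀ ℕ)} {f g : EndSeries k A ι} (h : Agree Δ f g) :
    Agree Δ g f :=
  fun v hv => (h v hv).symm

/-- The exponents on the same ray from the origin as `u`. -/
def ray (u : ι →₀ ℕ) : Set (ι →₀ ℕ) := {v | ∃ a b : ℕ, 0 < a ∧ 0 < b ∧ a • v = b • u}

theorem mem_ray_self (u : ι →₀ ℕ) : u ∈ ray u := ⟨1, 1, one_pos, one_pos, rfl⟩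

theorem mem_ray_symm {u v : ι →₀ ℕ} (h : v ∈ ray u) : u ∈ ray v := by
  obtain ⟨a, b, ha, hb, hab⟩ := h
  exact ⟨b, a, hb, ha, hab.symm⟩

theorem mem_ray_trans {u v w : ι →₀ ℕ} (h : w ∈ ray v) (h' : v ∈ ray u) : w ∈ ray u := by
  obtain ⟨a, b, ha, hb, hab⟩ := h
  obtain ⟨c, d, hc, hd, hcd⟩ := h'
  refine ⟨c * a, b * d, mul_pos hc ha, mul_pos hb hd, ?_⟩
  rw [mul_smul, hab, smul_comm, hcd, mul_smul]

theorem add_mem_ray {u v w : ι →₀ ℕ} (hv : v ∈ ray u) (hw : w ∈ ray u) : v + w ∈ ray u := by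
  obtain ⟨a, b, ha, hb, hab⟩ := hv
  obtain ⟨c, d, hc, hd, hcd⟩ := hw
  refine ⟨a * c, c * b + a * d, mul_pos ha hc, by positivity, ?_⟩
  rw [smul_add, mul_smul, mul_smul, smul_comm a c, hab, hcd, ← mul_smul, ← mul_smul, add_smul]

theorem mem_ray_of_add_eq {v z w : ι →₀ ℕ} (hv : v ∈ ray w) (hz : z ≠ 0) (h : v + z = w) :
    z ∈ ray w := by
  obtain ⟨a, b, ha, hb, hab⟩ := hv
  have key : b • w + a • z = a • w := by rw [← hab, ← smul_add, h]
  have hlt : b < a := by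
    by_contra! hle
    obtain ⟨i, hi⟩ := Finsupp.ne_iff.1 hz
    have h1 := DFunLike.congr_fun key i
    simp only [Finsupp.add_apply, Finsupp.smul_apply, smul_eq_mul] at h1
    have h2 := Nat.mul_le_mul_right (w i) hle
    have h3 : 0 < a * z i := mul_pos ha (Nat.pos_of_ne_zero hi)
    omega
  refine ⟨a, a - b, ha, Nat.sub_pos_of_lt hlt, ?_⟩
  have h1 : a • w = b • w + (a - b) • w := by rw [← add_smul, Nat.add_sub_cancel' hlt.le]
  rw [h1] at key
  exact add_left_cancel key

theorem mem_sdiff_iff {Δ : LowerSet (ι →₀ ℕ)} {O : Set (ι →₀ ℕ)} {v : ι →₀ ℕ} :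
    v ∈ Δ.sdiff O ↔ v ∈ Δ ∧ ∀ u ∈ O, ¬ u ≤ v := by
  change v ∈ (Δ : Set (ι →₀ ℕ)) \ (upperClosure O : UpperSet _) ↔ _
  simp [mem_upperClosure]

theorem eq_of_mem_ray_of_degree_eq {u v : ι →₀ ℕ} (h : v ∈ ray u)
    (hdeg : v.degree = u.degree) : v = u := by
  obtain ⟨a, b, ha, hb, hab⟩ := h
  by_cases hu : u.degree = 0
  · rw [hu] at hdeg
    rw [(Finsupp.degree_eq_zero_iff _).1 hu, (Finsupp.degree_eq_zero_iff _).1 hdeg]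
  have h1 := congrArg Finsupp.degree hab
  rw [map_nsmul, map_nsmul, hdeg, smul_eq_mul, smul_eq_mul] at h1
  have h2 : a = b := Nat.eq_of_mul_eq_mul_right (Nat.pos_of_ne_zero hu) h1
  subst h2
  ext i
  have := DFunLike.congr_fun hab i
  simp only [Finsupp.smul_apply, smul_eq_mul] at this
  exact Nat.eq_of_mul_eq_mul_left ha this

theorem eq_of_le_of_degree_le {u v : ι →₀ ℕ} (h : u ≤ v) (hdeg : v.degree ≤ u.degree) :
    v = u := by
  obtain ⟨c, rfl⟩ := exists_add_of_le h
  rw [map_add] at hdeg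
  have : c.degree = 0 := by omega
  rw [(Finsupp.degree_eq_zero_iff _).1 this, add_zero]

/-- The series with `v`-th coefficient the `φ v`-th coefficient of `f`. -/
noncomputable def reindex (φ : (ι →₀ ℕ) ≃+ (ι →₀ ℕ)) (f : EndSeries k A ι) : EndSeries k A ι :=
  fun v => f (φ v)

theorem coeff_reindex (φ : (ι →₀ ℕ) ≃+ (ι →₀ ℕ)) (f : EndSeries k A ι) (v : ι →₀ ℕ) :
    coeff v (reindex φ f) = coeff (φ v) f := rfl

variable [DecidableEq ι]

/-- The failure of the `w`-th Hasse–Schmidt identity for the family of coefficients of `f`. -/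
noncomputable def defect (f : EndSeries k A ι) (w : ι →₀ ℕ) (x y : A) : A :=
  coeff w f (x * y) - ∑ q ∈ antidiagonal w, coeff q.1 f x * coeff q.2 f y

theorem coeff_apply_mul (f : EndSeries k A ι) (w : ι →₀ ℕ) (x y : A) :
    coeff w f (x * y) =
      ∑ q ∈ antidiagonal w, coeff q.1 f x * coeff q.2 f y + defect f w x y := by
  simp [defect]

theorem coeff_mul_apply (f g : EndSeries k A ι) (w : ι →₀ ℕ) (x : A) :
    coeff w (f * g) x = ∑ q ∈ antidiagonal w, coeff q.1 f (coeff q.2 g x) := by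
  simp [coeff_mul, LinearMap.sum_apply]

theorem sum_antidiagonal_interchange {M : Type*} [AddCommMonoid M] (w : ι →₀ ℕ)
    (F : (ι →₀ ℕ) → (ι →₀ ℕ) → (ι →₀ ℕ) → (ι →₀ ℕ) → M) :
    ∑ p ∈ antidiagonal w, ∑ q ∈ antidiagonal p.2, ∑ r ∈ antidiagonal p.1,
        F r.1 q.1 r.2 q.2 =
      ∑ p ∈ antidiagonal w, ∑ q ∈ antidiagonal p.1, ∑ r ∈ antidiagonal p.2,
        F q.1 q.2 r.1 r.2 := by
  simp only [Finset.sum_sigma']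
  refine Finset.sum_bij'
    (fun s _ => ⟨(s.2.2.1 + s.2.1.1, s.2.2.2 + s.2.1.2), (s.2.2.1, s.2.1.1), (s.2.2.2, s.2.1.2)⟩)
    (fun s _ => ⟨(s.2.1.1 + s.2.2.1, s.2.1.2 + s.2.2.2), (s.2.1.2, s.2.2.2), (s.2.1.1, s.2.2.1)⟩)
    ?_ ?_ ?_ ?_ ?_
  · rintro ⟨⟨a, b⟩, ⟨c, d⟩, e, g⟩ h
    simp only [Finset.mem_sigma, mem_antidiagonal] at h ⊢
    obtain ⟨h1, h2, h3⟩ := h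
    refine ⟨?_, trivial, trivial⟩
    rw [← h1, ← h2, ← h3]; abel
  · rintro ⟨⟨a, b⟩, ⟨c, d⟩, e, g⟩ h
    simp only [Finset.mem_sigma, mem_antidiagonal] at h ⊢
    obtain ⟨h1, h2, h3⟩ := h
    refine ⟨?_, trivial, trivial⟩
    rw [← h1, ← h2, ← h3]; abel
  · rintro ⟨⟨a, b⟩, ⟨c, d⟩, e, g⟩ h
    simp only [Finset.mem_sigma, mem_antidiagonal] at h
    obtain ⟨h1, h2, h3⟩ := h
    subst h2 h3
    rfl
  · rintro ⟨⟨a, b⟩, ⟨c, d⟩, e, g⟩ h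
    simp only [Finset.mem_sigma, mem_antidiagonal] at h
    obtain ⟨h1, h2, h3⟩ := h
    subst h2 h3
    rfl
  · intros; rfl

theorem lt_of_mem_antidiagonal {w : ι →₀ ℕ} {q : (ι →₀ ℕ) × (ι →₀ ℕ)}
    (hq : q ∈ antidiagonal w) : (q.1 ≠ w → q.1 < w) ∧ (q.2 ≠ w → q.2 < w) := by
  rw [mem_antidiagonal] at hq
  exact ⟨fun h => lt_of_le_of_ne (hq ▸ le_self_add) h,
    fun h => lt_of_le_of_ne (hq ▸ le_add_self) h⟩

theorem defect_mul {f g : EndSeries k A ι} {w : ι →₀ ℕ} (hf0 : coeff 0 f = 1)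
    (hg0 : coeff 0 g = 1) (hf : ∀ v < w, ∀ x y, defect f v x y = 0)
    (hg : ∀ v < w, ∀ x y, defect g v x y = 0) (x y : A) :
    defect (f * g) w x y = defect f w x y + defect g w x y := by
  have hthird : ∑ p ∈ antidiagonal w, coeff p.1 f (defect g p.2 x y) = defect g w x y := by
    rw [Finset.sum_eq_single (0, w)]
    · simp [hf0]
    · rintro ⟨a, b⟩ hab hne
      rw [hg, map_zero]
      refine (lt_of_mem_antidiagonal hab).2 fun hb => hne ?_
      simp only [mem_antidiagonal] at hab
      dsimp only at hb
      subst hb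
      simpa using hab
    · simp
  have hsecond : ∑ p ∈ antidiagonal w, ∑ q ∈ antidiagonal p.2,
      defect f p.1 (coeff q.1 g x) (coeff q.2 g y) = defect f w x y := by
    rw [Finset.sum_eq_single (w, 0)]
    · simp [hg0]
    · rintro ⟨a, b⟩ hab hne
      refine Finset.sum_eq_zero fun q _ =>
        hf _ ((lt_of_mem_antidiagonal hab).1 fun hb => hne ?_) _ _
      simp only [mem_antidiagonal] at hab
      dsimp only at hb
      subst hb
      simpa using hab
    · simp
  rw [defect, coeff_mul_apply]
  simp only [coeff_apply_mul g, map_add, map_sum, coeff_apply_mul f, Finset.sum_add_distrib,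
    hthird, hsecond]
  simp only [coeff_mul_apply, Finset.sum_mul_sum]
  rw [sum_antidiagonal_interchange w
    (fun a b c d => coeff a f (coeff b g x) * coeff c f (coeff d g y))]
  abel

theorem defect_congr {f g : EndSeries k A ι} {w : ι →₀ ℕ}
    (h : ∀ v ≤ w, coeff v f = coeff v g) (x y : A) : defect f w x y = defect g w x y := by
  rw [defect, defect, h w le_rfl]
  congr 1
  refine Finset.sum_congr rfl fun q hq => ?_
  rw [mem_antidiagonal] at hq
  rw [h q.1 (hq ▸ le_self_add), h q.2 (hq ▸ le_add_self)]

theorem defect_one (w : ι →₀ ℕ) (x y : A) : defect (1 : EndSeries k A ι) w x y = 0 := by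
  by_cases hw : w = 0
  · subst hw; simp [defect]
  · rw [defect, coeff_one, if_neg hw, Finset.sum_eq_zero]
    · simp
    · rintro ⟨a, b⟩ hab
      simp only [mem_antidiagonal] at hab
      simp only [coeff_one]
      by_cases ha : a = 0
      · have hb : b ≠ 0 := by rintro rfl; simp_all
        simp [hb]
      · simp [ha]

/-- A set of exponents closed under addition and not containing zero. -/
structure PosSemigroup (ι : Type*) where
  carrier : Set (ι →₀ ℕ)
  add_mem : ∀ {u v}, u ∈ carrier → v ∈ carrier → u + v ∈ carrier
  zero_notMem : 0 ∉ carrier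

theorem SuppIn.mul {X Y Z : Set (ι →₀ ℕ)} {f g : EndSeries k A ι} (hf : SuppIn X f)
    (hg : SuppIn Y g) (h : ∀ u ∈ X, ∀ v ∈ Y, u + v ∈ Z) : SuppIn Z (f * g) := by
  intro v hv
  rw [coeff_mul]
  refine Finset.sum_eq_zero fun q hq => ?_
  rw [mem_antidiagonal] at hq
  by_cases h1 : q.1 ∈ X
  · by_cases h2 : q.2 ∈ Y
    · exact absurd (hq ▸ h _ h1 _ h2) hv
    · rw [hg _ h2, mul_zero]
  · rw [hf _ h1, zero_mul]

/-- The group of series `1 + ∑ e ∈ S, f e * X ^ e`. -/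
def supported (k A : Type*) [CommRing k] [Ring A] [Algebra k A] (S : PosSemigroup ι) :
    Subgroup (EndSeries k A ι)ˣ where
  carrier := {f | SuppIn S.carrier ((f : EndSeries k A ι) - 1)}
  one_mem' := fun v _ => by simp
  mul_mem' := by
    intro f g hf hg
    have h : ((f * g : (EndSeries k A ι)ˣ) : EndSeries k A ι) - 1 =
        (f - 1 : EndSeries k A ι) * (g - 1) + (f - 1) + (g - 1) := by
      rw [Units.val_mul]; simp only [sub_mul, mul_sub, mul_one, one_mul]; abel
    change SuppIn _ _
    rw [h]
    exact ((SuppIn.mul hf hg fun u hu v hv => S.add_mem hu hv).add hf).add hg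
  inv_mem' := by
    intro f hf v
    have h : ((f⁻¹ : (EndSeries k A ι)ˣ) : EndSeries k A ι) - 1 =
        -((f - 1 : EndSeries k A ι) + (f - 1) * ((f⁻¹ : (EndSeries k A ι)ˣ) - 1)) := by
      simp [sub_mul, mul_sub]
    induction v using WellFoundedLT.induction with
    | ind v ih =>
      intro hv
      rw [h, map_neg, map_add, hf v hv, coeff_mul, Finset.sum_eq_zero, add_zero, neg_zero]
      intro q hq
      rw [mem_antidiagonal] at hq
      by_cases h1 : q.1 ∈ S.carrier
      · have h2 : q.2 ∉ S.carrier := fun h2 => hv (hq ▸ S.add_mem h1 h2)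
        have hne : q.1 ≠ 0 := fun h0 => S.zero_notMem (h0 ▸ h1)
        rw [ih q.2 (hq ▸ lt_add_of_pos_left _ (pos_iff_ne_zero.2 hne)) h2, mul_zero]
      · rw [hf _ h1, zero_mul]

theorem mem_supported {S : PosSemigroup ι} {f : (EndSeries k A ι)ˣ} :
    f ∈ supported k A S ↔ SuppIn S.carrier ((f : EndSeries k A ι) - 1) := Iff.rfl

theorem mem_supported_iff {S : PosSemigroup ι} {f : (EndSeries k A ι)ˣ} :
    f ∈ supported k A S ↔ coeff 0 (f : EndSeries k A ι) = 1 ∧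
      ∀ v, v ≠ 0 → v ∉ S.carrier → coeff v (f : EndSeries k A ι) = 0 := by
  rw [mem_supported]
  constructor
  · intro h
    refine ⟨?_, fun v hv hS => ?_⟩
    · have := h 0 S.zero_notMem
      rwa [map_sub, coeff_one, if_pos rfl, sub_eq_zero] at this
    · have := h v hS
      rwa [map_sub, coeff_one, if_neg hv, sub_zero] at this
  · rintro ⟨h0, h⟩ v hv
    rw [map_sub, coeff_one]
    split_ifs with hv0
    · rw [hv0, h0, sub_self]
    · rw [h v hv0 hv, sub_zero]

theorem supported_mono {S T : PosSemigroup ι} (h : S.carrier ⊆ T.carrier) :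
    supported k A S ≤ supported k A T :=
  fun _ hf => SuppIn.mono hf h

theorem defect_eq_zero_of_supported {S : PosSemigroup ι} {f : (EndSeries k A ι)ˣ}
    (hf : f ∈ supported k A S) {w : ι →₀ ℕ} (hw : w ∉ S.carrier) (x y : A) :
    defect (f : EndSeries k A ι) w x y = 0 := by
  rw [mem_supported_iff] at hf
  by_cases hw0 : w = 0
  · subst hw0; simp [defect, hf.1]
  rw [← defect_one (k := k) w x y, defect, defect, hf.2 w hw0 hw, coeff_one, if_neg hw0]
  congr 1
  refine Finset.sum_congr rfl fun q hq => ?_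
  rw [mem_antidiagonal] at hq
  by_cases h1 : q.1 = 0
  · have h2 : q.2 = w := by rw [← hq, h1, zero_add]
    rw [h1, h2, hf.2 w hw0 hw, coeff_one, coeff_one, if_neg hw0]
    simp
  · by_cases h2 : q.2 = 0
    · have h1' : q.1 = w := by rw [← hq, h2, add_zero]
      rw [h2, h1', hf.2 w hw0 hw, coeff_one, coeff_one, if_neg hw0]
      simp
    · rw [coeff_one, coeff_one, if_neg h1, if_neg h2]
      by_cases h1S : q.1 ∈ S.carrier
      · rw [hf.2 _ h2 fun h2S => hw (hq ▸ S.add_mem h1S h2S)]; simp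
      · rw [hf.2 _ h1 h1S]; simp

theorem coeff_zero_mul {f g : EndSeries k A ι} (hf : coeff 0 f = 1) (hg : coeff 0 g = 1) :
    coeff 0 (f * g) = 1 := by
  simp [coeff_mul, hf, hg]

theorem coeff_zero_inv {f : (EndSeries k A ι)ˣ} (hf : coeff 0 (f : EndSeries k A ι) = 1) :
    coeff 0 ((f⁻¹ : (EndSeries k A ι)ˣ) : EndSeries k A ι) = 1 := by
  have h := congrArg (coeff 0) f.mul_inv
  rwa [coeff_mul, Finsupp.antidiagonal_zero, Finset.sum_singleton, hf, one_mul, coeff_one,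
    if_pos rfl] at h

theorem defect_inv {f : (EndSeries k A ι)ˣ} {w : ι →₀ ℕ}
    (hf0 : coeff 0 (f : EndSeries k A ι) = 1)
    (hf : ∀ v < w, ∀ x y, defect (f : EndSeries k A ι) v x y = 0) (x y : A) :
    defect ((f⁻¹ : (EndSeries k A ι)ˣ) : EndSeries k A ι) w x y =
      -defect (f : EndSeries k A ι) w x y := by
  induction w using WellFoundedLT.induction generalizing x y with
  | ind w ih =>
    have h := defect_mul hf0 (coeff_zero_inv hf0) hf (fun v hv x y => by
      rw [ih v hv (fun u hu => hf u (hu.trans hv)), hf v hv, neg_zero]) x y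
    rw [f.mul_inv, defect_one] at h
    exact (neg_eq_of_add_eq_zero_right h.symm).symm

/-- The group of Hasse–Schmidt families truncated to the exponents in `Δ`. -/
def truncHS (k A : Type*) [CommRing k] [Ring A] [Algebra k A] (Δ : LowerSet (ι →₀ ℕ)) :
    Subgroup (EndSeries k A ι)ˣ where
  carrier := {f | coeff 0 (f : EndSeries k A ι) = 1 ∧
    ∀ v ∈ Δ, ∀ x y, defect (f : EndSeries k A ι) v x y = 0}
  one_mem' := ⟨by simp, fun v _ => defect_one v⟩
  mul_mem' := by
    rintro f g ⟨hf0, hf⟩ ⟨hg0, hg⟩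
    refine ⟨coeff_zero_mul hf0 hg0, fun v hv x y => ?_⟩
    rw [Units.val_mul, defect_mul hf0 hg0 (fun u hu => hf u (Δ.lower hu.le hv))
      (fun u hu => hg u (Δ.lower hu.le hv)), hf v hv, hg v hv, add_zero]
  inv_mem' := by
    rintro f ⟨hf0, hf⟩
    refine ⟨coeff_zero_inv hf0, fun v hv x y => ?_⟩
    rw [defect_inv hf0 (fun u hu => hf u (Δ.lower hu.le hv)), hf v hv, neg_zero]

theorem truncHS_anti {Δ Δ' : LowerSet (ι →₀ ℕ)} (h : Δ' ≤ Δ) :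
    truncHS k A Δ ≤ truncHS k A Δ' :=
  fun _ hf => ⟨hf.1, fun v hv => hf.2 v (h hv)⟩

theorem Agree.mul {Δ : LowerSet (ι →₀ ℕ)} {f f' g g' : EndSeries k A ι} (hf : Agree Δ f f')
    (hg : Agree Δ g g') : Agree Δ (f * g) (f' * g') := by
  intro v hv
  rw [coeff_mul, coeff_mul]
  refine Finset.sum_congr rfl fun q hq => ?_
  rw [mem_antidiagonal] at hq
  rw [hf q.1 (Δ.lower (hq ▸ le_self_add) hv), hg q.2 (Δ.lower (hq ▸ le_add_self) hv)]

/-- The normal subgroup of series agreeing with `1` on `Δ`. -/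
def trivialOn (k A : Type*) [CommRing k] [Ring A] [Algebra k A] (Δ : LowerSet (ι →₀ ℕ)) :
    Subgroup (EndSeries k A ι)ˣ where
  carrier := {f | Agree Δ (f : EndSeries k A ι) 1}
  one_mem' := Agree.refl Δ _
  mul_mem' := by
    intro f g hf hg
    simpa using Agree.mul hf hg
  inv_mem' := by
    intro f hf
    have h := (Agree.mul (Agree.refl Δ ((f⁻¹ : (EndSeries k A ι)ˣ) : EndSeries k A ι)) hf).symm
    simpa using h

theorem mem_trivialOn {Δ : LowerSet (ι →₀ ℕ)} {f : (EndSeries k A ι)ˣ} :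
    f ∈ trivialOn k A Δ ↔ Agree Δ (f : EndSeries k A ι) 1 := Iff.rfl

theorem mul_inv_mem_trivialOn {Δ : LowerSet (ι →₀ ℕ)} {f g : (EndSeries k A ι)ˣ} :
    f * g⁻¹ ∈ trivialOn k A Δ ↔ Agree Δ (f : EndSeries k A ι) g := by
  rw [mem_trivialOn]
  constructor
  · intro h
    simpa using h.mul (Agree.refl Δ (g : EndSeries k A ι))
  · intro h
    simpa using h.mul (Agree.refl Δ ((g⁻¹ : (EndSeries k A ι)ˣ) : EndSeries k A ι))

theorem inv_mul_mem_trivialOn {Δ : LowerSet (ι →₀ ℕ)} {f g : (EndSeries k A ι)ˣ} :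
    f⁻¹ * g ∈ trivialOn k A Δ ↔ Agree Δ (f : EndSeries k A ι) g := by
  rw [mem_trivialOn]
  constructor
  · intro h
    simpa using ((Agree.refl Δ (f : EndSeries k A ι)).mul h).symm
  · intro h
    simpa using (Agree.refl Δ ((f⁻¹ : (EndSeries k A ι)ˣ) : EndSeries k A ι)).mul h.symm

theorem trivialOn_conj {Δ : LowerSet (ι →₀ ℕ)} {f : (EndSeries k A ι)ˣ}
    (hf : f ∈ trivialOn k A Δ) (g : (EndSeries k A ι)ˣ) : g * f * g⁻¹ ∈ trivialOn k A Δ := by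
  rw [mul_inv_mem_trivialOn]
  simpa using (Agree.refl Δ (g : EndSeries k A ι)).mul hf

/-- A commutator has support in `X` as soon as the two products agree outside `X`. -/
theorem commutator_mem_supported {X : PosSemigroup ι} {S T : PosSemigroup ι}
    {f g : (EndSeries k A ι)ˣ} (hf : f ∈ supported k A S) (hg : g ∈ supported k A T)
    (hS : ∀ u ∈ X.carrier, ∀ v ∈ S.carrier, u + v ∈ X.carrier)
    (hT : ∀ u ∈ X.carrier, ∀ v ∈ T.carrier, u + v ∈ X.carrier)
    (h : SuppIn X.carrier ((f * g).val - (g * f).val)) :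
    f * g * f⁻¹ * g⁻¹ ∈ supported k A X := by
  have absorb : ∀ {R : PosSemigroup ι} {c : EndSeries k A ι} {u : (EndSeries k A ι)ˣ},
      (∀ u ∈ X.carrier, ∀ v ∈ R.carrier, u + v ∈ X.carrier) → SuppIn X.carrier c →
      u ∈ supported k A R → SuppIn X.carrier (c * u.val) := by
    intro R c u hR hc hu
    have : c * u.val = c * (u.val - 1) + c := by
      rw [mul_sub, mul_one, sub_add_cancel]
    rw [this]
    exact (SuppIn.mul hc hu hR).add hc
  have key : (f * g * f⁻¹ * g⁻¹).val - 1 =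
      ((f * g).val - (g * f).val) * (f⁻¹).val * (g⁻¹).val := by
    simp [sub_mul, mul_assoc]
  rw [mem_supported, key]
  exact absorb hT (absorb hS h (inv_mem hf)) (inv_mem hg)

theorem commutator_mem_supported_of_add {X S T : PosSemigroup ι}
    {f g : (EndSeries k A ι)ˣ} (hf : f ∈ supported k A S) (hg : g ∈ supported k A T)
    (hS : ∀ u ∈ X.carrier, ∀ v ∈ S.carrier, u + v ∈ X.carrier)
    (hT : ∀ u ∈ X.carrier, ∀ v ∈ T.carrier, u + v ∈ X.carrier)
    (hST : ∀ u ∈ S.carrier, ∀ v ∈ T.carrier, u + v ∈ X.carrier) :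
    f * g * f⁻¹ * g⁻¹ ∈ supported k A X := by
  refine commutator_mem_supported hf hg hS hT ?_
  have : (f * g).val - (g * f).val =
      (f.val - 1) * (g.val - 1) - (g.val - 1) * (f.val - 1) := by
    simp only [Units.val_mul, sub_mul, mul_sub, mul_one, one_mul]; abel
  rw [this]
  exact (SuppIn.mul hf hg hST).sub
    (SuppIn.mul hg hf fun u hu v hv => add_comm v u ▸ hST v hv u hu)

theorem mem_truncHS_of_defect {Δ Δ' : LowerSet (ι →₀ ℕ)} {S : PosSemigroup ι}
    {f : (EndSeries k A ι)ˣ} (hf : f ∈ truncHS k A Δ') (hfS : f ∈ supported k A S)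
    (h : ∀ v ∈ Δ, v ∉ Δ' → v ∈ S.carrier → ∀ x y, defect f.val v x y = 0) :
    f ∈ truncHS k A Δ := by
  refine ⟨hf.1, fun v hv x y => ?_⟩
  by_cases hv' : v ∈ Δ'
  · exact hf.2 v hv' x y
  by_cases hS : v ∈ S.carrier
  · exact h v hv hv' hS x y
  · exact defect_eq_zero_of_supported hfS hS x y

theorem trivialOn_inf_supported_le (Δ : LowerSet (ι →₀ ℕ)) (S : PosSemigroup ι) :
    trivialOn k A Δ ⊓ supported k A S ≤ truncHS k A Δ := by
  rintro f ⟨hf, hfS⟩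
  refine ⟨(mem_supported_iff.1 hfS).1, fun v hv x y => ?_⟩
  rw [defect_congr (fun u hu => hf u (Δ.lower hu hv)), defect_one]

/-- Units with prescribed coefficients. -/
theorem exists_unit_coeff (c : (ι →₀ ℕ) → Module.End k A) :
    ∃ u : (EndSeries k A ι)ˣ, coeff 0 u.val = 1 ∧ ∀ v, v ≠ 0 → coeff v u.val = c v := by
  have hc : ∀ v, coeff v (fun v => if v = 0 then 1 else c v : EndSeries k A ι) =
      if v = 0 then 1 else c v := fun _ => rfl
  obtain ⟨u, hu⟩ := exists_unit _ ((hc 0).trans (if_pos rfl))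
  exact ⟨u, by rw [hu, hc, if_pos rfl], fun v hv => by rw [hu, hc, if_neg hv]⟩

theorem coeff_mul_eq_add {f g : EndSeries k A ι} {w : ι →₀ ℕ} (hw : w ≠ 0)
    (hf : coeff 0 f = 1) (hg : coeff 0 g = 1)
    (h : ∀ u v, u + v = w → u ≠ 0 → v ≠ 0 → coeff u f = 0 ∨ coeff v g = 0) :
    coeff w (f * g) = coeff w f + coeff w g := by
  have hne : ((0, w) : (ι →₀ ℕ) × (ι →₀ ℕ)) ≠ (w, 0) := fun h => hw (Prod.ext_iff.1 h).2
  rw [coeff_mul, ← Finset.sum_subset (s₁ := {(0, w), (w, 0)}), Finset.sum_pair hne, hf, hg,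
    one_mul, mul_one, add_comm]
  · intro q hq
    rw [mem_antidiagonal]
    rcases Finset.mem_insert.1 hq with rfl | hq
    · simp
    · rw [Finset.mem_singleton.1 hq]; simp
  · rintro ⟨a, b⟩ hq hq'
    rw [mem_antidiagonal] at hq
    dsimp only at hq ⊢
    simp only [Finset.mem_insert, Finset.mem_singleton, Prod.mk.injEq, not_or, not_and] at hq'
    have ha : a ≠ 0 := fun ha => hq'.1 ha (by rw [← hq, ha, zero_add])
    have hb : b ≠ 0 := fun hb => hq'.2 (by rw [← hq, hb, add_zero]) hb
    rcases h a b hq ha hb with h | h <;> rw [h] <;> simp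

/-- The part of `S` on the ray through `u`. -/
def rayPart (S : PosSemigroup ι) (u : ι →₀ ℕ) : PosSemigroup ι where
  carrier := S.carrier ∩ ray u
  add_mem := fun hv hw => ⟨S.add_mem hv.1 hw.1, add_mem_ray hv.2 hw.2⟩
  zero_notMem := fun h => S.zero_notMem h.1

theorem supported_rayPart_le (S : PosSemigroup ι) (u : ι →₀ ℕ) :
    supported k A (rayPart S u) ≤ supported k A S :=
  supported_mono Set.inter_subset_left

theorem supported_rayPart_le_of_mem {S : PosSemigroup ι} {u w : ι →₀ ℕ} (h : w ∈ ray u) :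
    supported k A (rayPart S u) ≤ supported k A (rayPart S w) :=
  supported_mono fun _ hv => ⟨hv.1, mem_ray_trans hv.2 (mem_ray_symm h)⟩

/-- The sums of an element of `S` and an element of `T`. -/
def sumSemigroup (S T : PosSemigroup ι) : PosSemigroup ι where
  carrier := {v | ∃ x ∈ S.carrier, ∃ z ∈ T.carrier, x + z = v}
  add_mem := by
    rintro _ _ ⟨x, hx, z, hz, rfl⟩ ⟨x', hx', z', hz', rfl⟩
    exact ⟨x + x', S.add_mem hx hx', z + z', T.add_mem hz hz', add_add_add_comm _ _ _ _⟩
  zero_notMem := by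
    rintro ⟨x, hx, z, hz, h⟩
    rw [add_eq_zero] at h
    exact S.zero_notMem (h.1 ▸ hx)

theorem commutator_mem_sumSemigroup {S T : PosSemigroup ι} {f g : (EndSeries k A ι)ˣ}
    (hf : f ∈ supported k A S) (hg : g ∈ supported k A T) :
    f * g * f⁻¹ * g⁻¹ ∈ supported k A (sumSemigroup S T) := by
  refine commutator_mem_supported_of_add hf hg ?_ ?_ fun u hu v hv => ⟨u, hu, v, hv, rfl⟩
  · rintro _ ⟨x, hx, z, hz, rfl⟩ v hv
    exact ⟨x + v, S.add_mem hx hv, z, hz, add_right_comm _ _ _⟩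
  · rintro _ ⟨x, hx, z, hz, rfl⟩ v hv
    exact ⟨x, hx, z + v, T.add_mem hz hv, (add_assoc _ _ _).symm⟩

/-- The truncated Hasse–Schmidt families supported on a single ray. -/
def rayGen (k A : Type*) [CommRing k] [Ring A] [Algebra k A] (S : PosSemigroup ι)
    (Δ : LowerSet (ι →₀ ℕ)) : Set (EndSeries k A ι)ˣ :=
  {f | f ∈ truncHS k A Δ ∧ ∃ u, f ∈ supported k A (rayPart S u)}

/-- The group generated by families on single rays and series trivial on `Δ`. -/
noncomputable def rayClosure (k A : Type*) [CommRing k] [Ring A] [Algebra k A] (S : PosSemigroup ι)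
    (Δ : LowerSet (ι →₀ ℕ)) : Subgroup (EndSeries k A ι)ˣ :=
  Subgroup.closure (rayGen k A S Δ ∪ (trivialOn k A Δ ⊓ supported k A S : Subgroup _))

theorem rayClosure_le (S : PosSemigroup ι) (Δ : LowerSet (ι →₀ ℕ)) :
    rayClosure k A S Δ ≤ truncHS k A Δ ⊓ supported k A S := by
  rw [rayClosure, Subgroup.closure_le]
  rintro f (⟨hf, u, hu⟩ | hf)
  · exact ⟨hf, supported_rayPart_le S u hu⟩
  · exact ⟨trivialOn_inf_supported_le Δ S hf, hf.2⟩

theorem rayClosure_mono {S T : PosSemigroup ι} (h : S.carrier ⊆ T.carrier)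
    (Δ : LowerSet (ι →₀ ℕ)) : rayClosure k A S Δ ≤ rayClosure k A T Δ := by
  refine Subgroup.closure_mono (Set.union_subset_union ?_ ?_)
  · rintro f ⟨hf, u, hu⟩
    exact ⟨hf, u, supported_mono (Set.inter_subset_inter_left _ h) hu⟩
  · exact fun f hf => ⟨hf.1, supported_mono h hf.2⟩

/-- Truncation of `z` to its `w`-th term. -/
theorem exists_single_term {S : PosSemigroup ι} {Δ : LowerSet (ι →₀ ℕ)} {w : ι →₀ ℕ}
    (hw : w ∈ S.carrier) (hwΔ : w ∉ Δ) (c : Module.End k A) :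
    ∃ e ∈ trivialOn k A Δ ⊓ supported k A (rayPart S w), coeff w e.val = c ∧
      ∀ v, v ≠ 0 → v ≠ w → coeff v e.val = 0 := by
  obtain ⟨e, he0, he⟩ := exists_unit_coeff (ι := ι) (fun v => if v = w then c else 0)
  have hw0 : w ≠ 0 := fun h => S.zero_notMem (h ▸ hw)
  refine ⟨e, ⟨?_, ?_⟩, ?_, fun v hv hvw => by rw [he v hv, if_neg hvw]⟩
  · intro v hv
    by_cases hv0 : v = 0
    · rw [hv0, he0, coeff_one, if_pos rfl]
    · have hvw : v ≠ w := fun h => hwΔ (h ▸ hv)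
      rw [he v hv0, if_neg hvw, coeff_one, if_neg hv0]
  · refine mem_supported_iff.2 ⟨he0, fun v hv hvS => ?_⟩
    rw [he v hv, if_neg]
    rintro rfl
    exact hvS ⟨hw, mem_ray_self _⟩
  · rw [he w hw0, if_pos rfl]

theorem closure_conj_mem {G : Type*} [Group G] {X : Set G} {b : G}
    (h : ∀ g ∈ X, b * g * b⁻¹ ∈ Subgroup.closure X) {g : G} (hg : g ∈ Subgroup.closure X) :
    b * g * b⁻¹ ∈ Subgroup.closure X := by
  have : Subgroup.closure X ≤ (Subgroup.closure X).comap (MulAut.conj b).toMonoidHom := by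
    rw [Subgroup.closure_le]
    exact fun g hg => h g hg
  exact this hg

theorem truncHS_inf_supported_le (N : ℕ) (Δ : LowerSet (ι →₀ ℕ)) (S : PosSemigroup ι)
    (hΔ : (Δ : Set (ι →₀ ℕ)).Finite) (hN : (S.carrier ∩ Δ).ncard = N) :
    truncHS k A Δ ⊓ supported k A S ≤ rayClosure k A S Δ := by
  induction N using Nat.strong_induction_on generalizing Δ S with
  | _ N ih =>
  intro f hfmem
  obtain ⟨hf, hfS⟩ := Subgroup.mem_inf.1 hfmem
  have hfin : (S.carrier ∩ Δ).Finite := hΔ.subset Set.inter_subset_right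
  rcases (S.carrier ∩ Δ).eq_empty_or_nonempty with hemp | hne
  · refine Subgroup.subset_closure (Or.inr ⟨fun v hv => ?_, hfS⟩)
    have := hfS v fun hS => Set.eq_empty_iff_forall_notMem.1 hemp v ⟨hS, hv⟩
    rwa [map_sub, sub_eq_zero] at this
  obtain ⟨w, ⟨hwS, hwΔ⟩, hwmax⟩ := hfin.exists_maximal hne
  have hw0 : w ≠ 0 := fun h => S.zero_notMem (h ▸ hwS)
  set Δ' := Δ.sdiff {w} with hΔ'
  have hle : Δ' ≤ Δ := LowerSet.sdiff_le_left
  have hwΔ' : w ∉ Δ' := fun h => (mem_sdiff_iff.1 h).2 w rfl le_rfl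
  have hrest : ∀ v ∈ Δ, v ∉ Δ' → v ∈ S.carrier → v = w := by
    intro v hv hv' hvS
    have : w ≤ v := by
      by_contra h
      exact hv' (mem_sdiff_iff.2 ⟨hv, fun u hu => by rwa [Set.mem_singleton_iff.1 hu]⟩)
    exact le_antisymm (hwmax ⟨hvS, hv⟩ this) this
  have hbelow : ∀ v < w, v ∈ Δ' := fun v hv => mem_sdiff_iff.2
    ⟨Δ.lower hv.le hwΔ, fun u hu => by rw [Set.mem_singleton_iff.1 hu]; exact not_le_of_gt hv⟩
  have hext : ∀ g ∈ truncHS k A Δ', g ∈ supported k A S → (∀ x y, defect g.val w x y = 0) →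
      g ∈ truncHS k A Δ := fun g hg hgS hd =>
    mem_truncHS_of_defect hg hgS fun v hv hv' hvS => by rw [hrest v hv hv' hvS]; exact hd
  have ih₁ : truncHS k A Δ' ⊓ supported k A S ≤ rayClosure k A S Δ' := by
    refine ih _ ?_ Δ' S (hΔ.subset hle) rfl
    rw [← hN]
    refine Set.ncard_lt_ncard ?_ hfin
    exact ⟨Set.inter_subset_inter_right _ hle, fun h => hwΔ' (h ⟨hwS, hwΔ⟩).2⟩
  have ih₂ : ∀ T : PosSemigroup ι, T.carrier ⊆ S.carrier → w ∉ T.carrier →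
      truncHS k A Δ ⊓ supported k A T ≤ rayClosure k A S Δ := by
    intro T hT hwT
    refine (ih _ ?_ Δ T hΔ rfl).trans (rayClosure_mono hT Δ)
    rw [← hN]
    refine Set.ncard_lt_ncard ?_ hfin
    exact ⟨Set.inter_subset_inter_left _ hT, fun h => hwT (h ⟨hwS, hwΔ⟩).1⟩
  set B := truncHS k A Δ' ⊓ supported k A (rayPart S w) with hB
  have hconj : ∀ b ∈ B, ∀ g ∈ rayClosure k A S Δ, b * g * b⁻¹ ∈ rayClosure k A S Δ := by
    intro b hbmem g hg
    obtain ⟨hb, hbS⟩ := Subgroup.mem_inf.1 hbmem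
    have hbS' := supported_rayPart_le S w hbS
    refine closure_conj_mem ?_ hg
    rintro y (⟨hy, u, hyu⟩ | ⟨hy, hyS⟩)
    · by_cases hwu : w ∈ ray u
      · have hyw := supported_rayPart_le_of_mem hwu hyu
        have hmem : b * y * b⁻¹ ∈ supported k A (rayPart S w) :=
          mul_mem (mul_mem hbS hyw) (inv_mem hbS)
        refine Subgroup.subset_closure (Or.inl ⟨hext _ ?_ (supported_rayPart_le S w hmem) ?_,
          w, hmem⟩)
        · exact mul_mem (mul_mem hb (truncHS_anti hle hy)) (inv_mem hb)
        · intro x z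
          have hb' : ∀ v < w, ∀ x y, defect b.val v x y = 0 := fun v hv => hb.2 v (hbelow v hv)
          have hy' : ∀ v < w, ∀ x z, defect y.val v x z = 0 :=
            fun v hv => hy.2 v (hle (hbelow v hv))
          have hby : ∀ v < w, ∀ x z, defect (b * y).val v x z = 0 :=
            fun v hv => (mul_mem hb (truncHS_anti hle hy)).2 v (hbelow v hv)
          rw [Units.val_mul (b * y), defect_mul (f := (b * y).val)
            (coeff_zero_mul (f := b.val) hb.1 hy.1) (coeff_zero_inv hb.1) hby
            (fun v hv => (inv_mem hb).2 v (hbelow v hv)), Units.val_mul,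
            defect_mul hb.1 hy.1 hb' hy', defect_inv hb.1 hb', hy.2 w hwΔ]
          abel
      · have hc := commutator_mem_sumSemigroup hbS hyu
        have hsub : (sumSemigroup (rayPart S w) (rayPart S u)).carrier ⊆ S.carrier := by
          rintro _ ⟨x, hx, z, hz, rfl⟩
          exact S.add_mem hx.1 hz.1
        have hwT : w ∉ (sumSemigroup (rayPart S w) (rayPart S u)).carrier := by
          rintro ⟨x, hx, z, hz, h⟩
          have hz0 : z ≠ 0 := fun h0 => S.zero_notMem (h0 ▸ hz.1)
          exact hwu (mem_ray_trans (mem_ray_symm (mem_ray_of_add_eq hx.2 hz0 h)) hz.2)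
        have hcΔ' : b * y * b⁻¹ * y⁻¹ ∈ truncHS k A Δ' :=
          mul_mem (mul_mem (mul_mem hb (truncHS_anti hle hy)) (inv_mem hb))
            (inv_mem (truncHS_anti hle hy))
        have hcΔ := hext _ hcΔ' (supported_mono hsub hc) (defect_eq_zero_of_supported hc hwT)
        have hy'' : y ∈ rayClosure k A S Δ := Subgroup.subset_closure (Or.inl ⟨hy, u, hyu⟩)
        have := mul_mem (ih₂ _ hsub hwT ⟨hcΔ, hc⟩) hy''
        rwa [inv_mul_cancel_right] at this
    · exact Subgroup.subset_closure (Or.inr (Subgroup.mem_inf.2 ⟨trivialOn_conj hy b,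
        mul_mem (mul_mem hbS' hyS) (inv_mem hbS')⟩))
  have hnorm : B ≤ Subgroup.normalizer (rayClosure k A S Δ) := by
    intro b hb
    rw [Subgroup.mem_normalizer_iff]
    refine fun g => ⟨hconj b hb g, fun hg => ?_⟩
    have := hconj b⁻¹ (inv_mem hb) _ hg
    simpa [mul_assoc] using this
  have hdecomp : rayClosure k A S Δ' ≤ rayClosure k A S Δ ⊔ B := by
    rw [rayClosure, Subgroup.closure_le]
    rintro y (⟨hy, u, hyu⟩ | ⟨hy, hyS⟩)
    · by_cases hwu : w ∈ ray u
      · exact Subgroup.mem_sup_right ⟨hy, supported_rayPart_le_of_mem hwu hyu⟩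
      · refine Subgroup.mem_sup_left (Subgroup.subset_closure (Or.inl ⟨?_, u, hyu⟩))
        exact hext y hy (supported_rayPart_le S u hyu)
          (defect_eq_zero_of_supported hyu fun h => hwu h.2)
    · obtain ⟨e, he, hew, hev⟩ := exists_single_term hwS hwΔ' (coeff w y.val)
      obtain ⟨heΔ, heS⟩ := Subgroup.mem_inf.1 he
      have heB : e ∈ B := ⟨trivialOn_inf_supported_le Δ' _ ⟨heΔ, heS⟩, heS⟩
      have hey : e⁻¹ * y ∈ rayClosure k A S Δ := by
        refine Subgroup.subset_closure (Or.inr (Subgroup.mem_inf.2 ⟨?_, mul_mem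
          (inv_mem (supported_rayPart_le S w heS)) hyS⟩))
        refine inv_mul_mem_trivialOn.2 fun v hv => ?_
        by_cases hv' : v ∈ Δ'
        · rw [heΔ v hv', hy v hv']
        by_cases hvw : v = w
        · rw [hvw, hew]
        · have hvS : v ∉ S.carrier := fun h => hvw (hrest v hv hv' h)
          have hv0 : v ≠ 0 := by
            rintro rfl
            exact hv' (hbelow 0 (pos_iff_ne_zero.2 hw0))
          rw [hev v hv0 hvw, (mem_supported_iff.1 hyS).2 v hv0 hvS]
      have := mul_mem (Subgroup.mem_sup_right heB) (Subgroup.mem_sup_left (T := B) hey)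
      simpa using this
  have hmem : f ∈ (↑(rayClosure k A S Δ ⊔ B) : Set (EndSeries k A ι)ˣ) :=
    hdecomp (ih₁ ⟨truncHS_anti hle hf, hfS⟩)
  rw [Subgroup.coe_mul_of_right_le_normalizer_left _ _ hnorm] at hmem
  obtain ⟨y, hy, b, hb, rfl⟩ := hmem
  refine mul_mem hy (Subgroup.subset_closure (Or.inl ⟨?_, w, hb.2⟩))
  have := mul_mem (inv_mem (Subgroup.mem_inf.1 (rayClosure_le S Δ hy)).1) hf
  simpa using this

/-- Any defect of a truncated family just outside `Δ` is realised on a single ray. -/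
theorem exists_ray_defect_eq {Δ : LowerSet (ι →₀ ℕ)} {S : PosSemigroup ι}
    (hΔ : (Δ : Set (ι →₀ ℕ)).Finite) {w : ι →₀ ℕ} (hwS : w ∈ S.carrier) (hwΔ : w ∉ Δ)
    (hbelow : ∀ v < w, v ∈ Δ) {h : (EndSeries k A ι)ˣ}
    (hh : h ∈ truncHS k A Δ ⊓ supported k A S) :
    ∃ β ∈ truncHS k A Δ ⊓ supported k A (rayPart S w),
      ∀ x y, defect β.val w x y = defect h.val w x y := by
  have hmem := truncHS_inf_supported_le _ Δ S hΔ rfl hh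
  have below : ∀ {g}, g ∈ truncHS k A Δ → ∀ v < w, ∀ x y, defect g.val v x y = 0 :=
    fun hg v hv => hg.2 v (hbelow v hv)
  clear hh
  induction hmem using Subgroup.closure_induction with
  | mem g hg =>
    rcases hg with ⟨hg, u, hgu⟩ | ⟨hg, hgS⟩
    · by_cases hwu : w ∈ ray u
      · exact ⟨g, ⟨hg, supported_rayPart_le_of_mem hwu hgu⟩, fun _ _ => rfl⟩
      · refine ⟨1, one_mem _, fun x y => ?_⟩
        rw [defect_eq_zero_of_supported hgu fun h => hwu h.2]
        exact defect_one w x y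
    · obtain ⟨e, ⟨heΔ, heS⟩, hew, -⟩ := exists_single_term hwS hwΔ (coeff w g.val)
      refine ⟨e, ⟨trivialOn_inf_supported_le Δ _ ⟨heΔ, heS⟩, heS⟩, fun x y => ?_⟩
      refine defect_congr (fun v hv => ?_) x y
      rcases hv.eq_or_lt with rfl | hv
      · exact hew
      · rw [heΔ v (hbelow v hv), hg v (hbelow v hv)]
  | one => exact ⟨1, one_mem _, fun _ _ => rfl⟩
  | mul f g hf hg ihf ihg =>
    obtain ⟨β, hβ, hβd⟩ := ihf
    obtain ⟨γ, hγ, hγd⟩ := ihg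
    have hf := (Subgroup.mem_inf.1 (rayClosure_le S Δ hf)).1
    have hg := (Subgroup.mem_inf.1 (rayClosure_le S Δ hg)).1
    refine ⟨β * γ, mul_mem hβ hγ, fun x y => ?_⟩
    rw [Units.val_mul, Units.val_mul, defect_mul hβ.1.1 hγ.1.1 (below hβ.1) (below hγ.1),
      defect_mul hf.1 hg.1 (below hf) (below hg), hβd, hγd]
  | inv f hf ihf =>
    obtain ⟨β, hβ, hβd⟩ := ihf
    have hf := (Subgroup.mem_inf.1 (rayClosure_le S Δ hf)).1
    refine ⟨β⁻¹, inv_mem hβ, fun x y => ?_⟩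
    rw [defect_inv hβ.1.1 (below hβ.1), defect_inv hf.1 (below hf), hβd]

/-- The exponents all of whose entries are less than `n`. -/
def box (ι : Type*) (n : ℕ) : LowerSet (ι →₀ ℕ) where
  carrier := {v | ∀ i, v i < n}
  lower' := fun _ _ h hv i => (h i).trans_lt (hv i)

theorem finite_box (ι : Type*) [Finite ι] (n : ℕ) : (box ι n : Set (ι →₀ ℕ)).Finite := by
  refine Set.Finite.of_finite_image (f := fun v : ι →₀ ℕ => (v : ι → ℕ)) ?_
    DFunLike.coe_injective.injOn
  refine (Set.Finite.pi' (t := fun _ : ι => Set.Iio n) fun _ => Set.finite_Iio n).subset ?_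
  rintro _ ⟨v, hv, rfl⟩ i
  exact hv i

/-- The nonzero exponents on the `i`-th coordinate axis. -/
noncomputable def axis (i : ι) : PosSemigroup ι where
  carrier := {v | v ≠ 0 ∧ v = Finsupp.single i (v i)}
  add_mem := by
    rintro u v ⟨hu, hu'⟩ ⟨hv, hv'⟩
    refine ⟨fun h => hu (add_eq_zero.1 h).1, ?_⟩
    rw [Finsupp.add_apply, Finsupp.single_add, ← hu', ← hv']
  zero_notMem := fun h => h.1 rfl

theorem exists_axis_series {n : ℕ} (i : ι) {α : ℕ → Module.End k A} (h0 : α 0 = 1)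
    (hα : ∀ m < n, ∀ x y : A, α m (x * y) = ∑ j ∈ Finset.range (m + 1), α j x * α (m - j) y) :
    ∃ f ∈ truncHS k A (box ι n) ⊓ supported k A (axis i),
      ∀ m, coeff (Finsupp.single i m) f.val = α m := by
  obtain ⟨f, hf0, hf⟩ := exists_unit_coeff (ι := ι)
    (fun v => if v = Finsupp.single i (v i) then α (v i) else 0)
  have hcoeff : ∀ m, coeff (Finsupp.single i m) f.val = α m := by
    intro m
    rcases Nat.eq_zero_or_pos m with rfl | hm
    · rw [Finsupp.single_zero, hf0, h0]
    · rw [hf _ (by simpa using hm.ne'), Finsupp.single_eq_same, if_pos rfl]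
  have hsupp : f ∈ supported k A (axis i) := by
    refine mem_supported_iff.2 ⟨hf0, fun v hv hvS => ?_⟩
    rw [hf v hv, if_neg fun h => hvS ⟨hv, h⟩]
  refine ⟨f, Subgroup.mem_inf.2 ⟨⟨hf0, fun v hv x y => ?_⟩, hsupp⟩, hcoeff⟩
  by_cases hvS : v ∈ (axis i).carrier
  · rw [hvS.2, defect, hcoeff, hα _ (hv i), Finsupp.antidiagonal_single, Finset.sum_map,
      Finset.Nat.sum_antidiagonal_eq_sum_range_succ_mk, sub_eq_zero]
    refine Finset.sum_congr rfl fun j _ => ?_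
    change _ = coeff (Finsupp.single i j) f.val x * coeff (Finsupp.single i (v i - j)) f.val y
    rw [hcoeff, hcoeff]
  · exact defect_eq_zero_of_supported hsupp hvS x y

theorem coeff_mul_axis {i j : ι} (hij : i ≠ j) {f g : (EndSeries k A ι)ˣ}
    (hf : f ∈ supported k A (axis i)) (hg : g ∈ supported k A (axis j)) (a b : ℕ) :
    coeff (Finsupp.single i a + Finsupp.single j b) (f * g).val =
      coeff (Finsupp.single i a) f.val * coeff (Finsupp.single j b) g.val := by
  rw [Units.val_mul, coeff_mul,
    Finset.sum_eq_single (Finsupp.single i a, Finsupp.single j b)]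
  · rintro ⟨u, v⟩ huv hne
    rw [mem_antidiagonal] at huv
    dsimp only at huv ⊢
    have hu : u ≠ Finsupp.single i (u i) → coeff u f.val = 0 := fun h =>
      (mem_supported_iff.1 hf).2 u (by rintro rfl; simp at h) fun h' => h h'.2
    have hv : v ≠ Finsupp.single j (v j) → coeff v g.val = 0 := fun h =>
      (mem_supported_iff.1 hg).2 v (by rintro rfl; simp at h) fun h' => h h'.2
    by_cases hu' : u = Finsupp.single i (u i)
    · by_cases hv' : v = Finsupp.single j (v j)
      · refine absurd ?_ hne
        rw [hu', hv'] at huv ⊢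
        have h1 := DFunLike.congr_fun huv i
        have h2 := DFunLike.congr_fun huv j
        simp [hij, hij.symm] at h1 h2
        rw [h1, h2]
      · rw [hv hv', mul_zero]
    · rw [hu hu', zero_mul]
  · intro h
    simp at h

/-- The exponent all of whose entries are equal to `m`. -/
noncomputable def diag (ι : Type*) [Finite ι] (m : ℕ) : ι →₀ ℕ :=
  Finsupp.equivFunOnFinite.symm fun _ => m

section diag

variable {ι : Type*} [Finite ι]

@[simp]
theorem diag_apply (m : ℕ) (i : ι) : diag ι m i = m := rfl

@[simp]
theorem diag_zero : diag ι 0 = 0 := Finsupp.ext fun _ => rfl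

theorem diag_add (a b : ℕ) : diag ι a + diag ι b = diag ι (a + b) :=
  Finsupp.ext fun _ => rfl

theorem diag_injective [Nonempty ι] : Function.Injective (diag ι) :=
  fun _ _ h => DFunLike.congr_fun h (Classical.arbitrary ι)

theorem diag_mem_box {m n : ℕ} (h : m < n) : diag ι m ∈ box ι n := fun _ => h

theorem exists_diag_eq_of_mem_ray [Nonempty ι] {v : ι →₀ ℕ} (hv : v ∈ ray (diag ι 1)) :
    ∃ m, v = diag ι m := by
  obtain ⟨a, b, ha, hb, hab⟩ := hv
  refine ⟨v (Classical.arbitrary ι), Finsupp.ext fun i => ?_⟩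
  have h1 := DFunLike.congr_fun hab i
  have h2 := DFunLike.congr_fun hab (Classical.arbitrary ι)
  simp only [Finsupp.smul_apply, diag_apply, smul_eq_mul] at h1 h2
  exact Nat.eq_of_mul_eq_mul_left ha (h1.trans h2.symm)

variable [DecidableEq ι]

open scoped Classical in
/-- The diagonal coefficients of a truncated family form a one-variable family, provided the
off-diagonal contributions cancel. -/
theorem isFinIntegrable_of_diag [Nonempty ι] {n : ℕ} {f : EndSeries k A ι}
    (h0 : coeff 0 f = 1) (hdef : ∀ m < n, ∀ x y, defect f (diag ι m) x y = 0)
    (hoff : ∀ m < n, ∀ x y, ∑ q ∈ antidiagonal (diag ι m) with ¬ ∃ j, q.1 = diag ι j,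
      coeff q.1 f x * coeff q.2 f y = 0) :
    IsFinIntegrable k A 1 n (coeff (diag ι 1) f) := by
  refine ⟨fun m => coeff (diag ι m) f, by simp only [diag_zero, h0]; rfl,
    fun i h1 h2 => absurd h1 (by omega), rfl, fun m hm x y => ?_⟩
  have h := coeff_apply_mul f (diag ι m) x y
  rw [hdef m hm, add_zero, ← Finset.sum_filter_add_sum_filter_not _
    (fun q => ∃ j, q.1 = diag ι j), hoff m hm, add_zero] at h
  rw [h]
  symm
  refine Finset.sum_bij (fun j _ => (diag ι j, diag ι (m - j))) ?_ ?_ ?_ ?_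
  · intro j hj
    rw [Finset.mem_range] at hj
    rw [Finset.mem_filter, mem_antidiagonal, diag_add, Nat.add_sub_cancel' (by omega)]
    exact ⟨rfl, j, rfl⟩
  · intro a _ b _ hab
    exact diag_injective (Prod.ext_iff.1 hab).1
  · rintro ⟨u, v⟩ huv
    rw [Finset.mem_filter, mem_antidiagonal] at huv
    obtain ⟨huv, j, hj⟩ := huv
    dsimp only at huv hj
    have key : ∀ i, j + v i = m := fun i => by
      have := DFunLike.congr_fun huv i
      simpa [hj] using this
    have hjm : j ≤ m := by
      have := key (Classical.arbitrary ι)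
      omega
    refine ⟨j, Finset.mem_range.2 (by omega), Prod.ext hj.symm (Finsupp.ext fun i => ?_)⟩
    have := key i
    simp only [diag_apply]
    omega
  · intros; rfl

end diag

/-- An indecomposable coefficient of a truncated family is realised on a single ray. -/
theorem exists_ray_coeff_eq {Δ : LowerSet (ι →₀ ℕ)} {S : PosSemigroup ι}
    (hΔ : (Δ : Set (ι →₀ ℕ)).Finite) {d : ι →₀ ℕ} (hd0 : d ≠ 0) (hdΔ : d ∈ Δ)
    (hd : ∀ u ∈ S.carrier, ∀ v ∈ S.carrier, u + v ≠ d) {h : (EndSeries k A ι)ˣ}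
    (hh : h ∈ truncHS k A Δ ⊓ supported k A S) :
    ∃ ε ∈ truncHS k A Δ ⊓ supported k A (rayPart S d), coeff d ε.val = coeff d h.val := by
  have hadd : ∀ {f g : (EndSeries k A ι)ˣ}, f ∈ supported k A S → g ∈ supported k A S →
      coeff d (f * g).val = coeff d f.val + coeff d g.val := by
    intro f g hf hg
    rw [mem_supported_iff] at hf hg
    refine coeff_mul_eq_add hd0 hf.1 hg.1 fun u v huv hu hv => ?_
    by_cases huS : u ∈ S.carrier
    · exact Or.inr (hg.2 v hv fun hvS => hd u huS v hvS huv)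
    · exact Or.inl (hf.2 u hu huS)
  have hone : coeff d (1 : (EndSeries k A ι)ˣ).val = 0 := by
    rw [Units.val_one, coeff_one, if_neg hd0]
  have hinv : ∀ {f : (EndSeries k A ι)ˣ}, f ∈ supported k A S →
      coeff d (f⁻¹).val = -coeff d f.val := by
    intro f hf
    have := hadd hf (inv_mem hf)
    rw [mul_inv_cancel, hone] at this
    exact (neg_eq_of_add_eq_zero_right this.symm).symm
  have hmem := truncHS_inf_supported_le _ Δ S hΔ rfl hh
  clear hh
  induction hmem using Subgroup.closure_induction with
  | mem g hg =>
    rcases hg with ⟨hg, u, hgu⟩ | ⟨hg, hgS⟩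
    · by_cases hdu : d ∈ ray u
      · exact ⟨g, ⟨hg, supported_rayPart_le_of_mem hdu hgu⟩, rfl⟩
      · refine ⟨1, one_mem _, ?_⟩
        rw [hone, (mem_supported_iff.1 hgu).2 d hd0 fun h => hdu h.2]
    · exact ⟨1, one_mem _, (hg d hdΔ).symm⟩
  | one => exact ⟨1, one_mem _, rfl⟩
  | mul f g hf hg ihf ihg =>
    obtain ⟨β, hβ, hβd⟩ := ihf
    obtain ⟨γ, hγ, hγd⟩ := ihg
    refine ⟨β * γ, mul_mem hβ hγ, ?_⟩
    rw [hadd (supported_rayPart_le S d hβ.2) (supported_rayPart_le S d hγ.2), hβd, hγd,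
      hadd (rayClosure_le S Δ hf).2 (rayClosure_le S Δ hg).2]
  | inv f hf ihf =>
    obtain ⟨β, hβ, hβd⟩ := ihf
    refine ⟨β⁻¹, inv_mem hβ, ?_⟩
    rw [hinv (supported_rayPart_le S d hβ.2), hinv (rayClosure_le S Δ hf).2, hβd]

/-- The exponents in two variables involving both of them. -/
def bothPos : PosSemigroup (Fin 2) where
  carrier := {v | 0 < v 0 ∧ 0 < v 1}
  add_mem := fun hu _ => ⟨Nat.add_pos_left hu.1 _, Nat.add_pos_left hu.2 _⟩
  zero_notMem := fun h => absurd h.1 (lt_irrefl 0)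

open scoped Classical in
theorem isFinIntegrable_commutator {n : ℕ} (hn : 1 < n) {D D' : A →ₗ[k] A}
    (hD : IsFinIntegrable k A 1 n D) (hD' : IsFinIntegrable k A 1 n D') :
    IsFinIntegrable k A 1 n (D ∘ₗ D' - D' ∘ₗ D) := by
  obtain ⟨α, hα0, -, rfl, hα⟩ := hD
  obtain ⟨β, hβ0, -, rfl, hβ⟩ := hD'
  obtain ⟨f, hf, hfc⟩ := exists_axis_series (k := k) (A := A) (0 : Fin 2) hα0 hα
  obtain ⟨g, hg, hgc⟩ := exists_axis_series (k := k) (A := A) (1 : Fin 2) hβ0 hβ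
  obtain ⟨hf, hfS⟩ := Subgroup.mem_inf.1 hf
  obtain ⟨hg, hgS⟩ := Subgroup.mem_inf.1 hg
  have hpos : ∀ (i : Fin 2), ∀ v ∈ (axis i).carrier, 0 < v i := by
    rintro i v ⟨hv0, hv⟩
    refine Nat.pos_of_ne_zero fun h => hv0 ?_
    rw [hv, h, Finsupp.single_zero]
  have hγS : f * g * f⁻¹ * g⁻¹ ∈ supported k A bothPos := by
    refine commutator_mem_supported_of_add hfS hgS ?_ ?_ fun u hu v hv => ?_
    · exact fun u hu v _ => ⟨Nat.add_pos_left hu.1 _, Nat.add_pos_left hu.2 _⟩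
    · exact fun u hu v _ => ⟨Nat.add_pos_left hu.1 _, Nat.add_pos_left hu.2 _⟩
    · exact ⟨Nat.add_pos_left (hpos 0 u hu) _, Nat.add_pos_right _ (hpos 1 v hv)⟩
  have hγ : f * g * f⁻¹ * g⁻¹ ∈ truncHS k A (box (Fin 2) n) :=
    mul_mem (mul_mem (mul_mem hf hg) (inv_mem hf)) (inv_mem hg)
  have hd0 : diag (Fin 2) 1 ≠ 0 := fun h => by simpa using DFunLike.congr_fun h 0
  have hd : ∀ u ∈ bothPos.carrier, ∀ v, u + v = diag (Fin 2) 1 → v = 0 := by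
    rintro u ⟨hu0, hu1⟩ v huv
    ext i
    have h0 := DFunLike.congr_fun huv i
    simp only [Finsupp.add_apply, diag_apply, Finsupp.zero_apply] at h0 ⊢
    have : 0 < u i := by fin_cases i <;> assumption
    omega
  have hγc : coeff (diag (Fin 2) 1) (f * g * f⁻¹ * g⁻¹).val = α 1 ∘ₗ β 1 - β 1 ∘ₗ α 1 := by
    have hdiag : diag (Fin 2) 1 = Finsupp.single 0 1 + Finsupp.single 1 1 := by
      ext i; fin_cases i <;> simp
    have hfg : coeff (diag (Fin 2) 1) (f * g).val = α 1 * β 1 := by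
      rw [hdiag, coeff_mul_axis (by decide) hfS hgS, hfc, hgc]
    have hgf : coeff (diag (Fin 2) 1) (g * f).val = β 1 * α 1 := by
      rw [hdiag, add_comm, coeff_mul_axis (by decide) hgS hfS, hfc, hgc]
    have hprod : f * g = f * g * f⁻¹ * g⁻¹ * (g * f) := by group
    rw [hprod, Units.val_mul _ (g * f), coeff_mul_eq_add (g := (g * f).val) hd0 hγ.1
      (coeff_zero_mul hg.1 hf.1)]
      at hfg
    · rw [hgf] at hfg
      exact eq_sub_of_add_eq hfg
    · exact fun u v huv hu hv => Or.inl ((mem_supported_iff.1 hγS).2 u hu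
        fun h => hv (hd u h v huv))
  obtain ⟨ε, hε, hεd⟩ := exists_ray_coeff_eq (finite_box _ n) hd0 (diag_mem_box hn)
    (fun u hu v hv huv => bothPos.zero_notMem (hd u hu v huv ▸ hv)) ⟨hγ, hγS⟩
  rw [← hγc, ← hεd]
  refine isFinIntegrable_of_diag hε.1.1 (fun m hm => hε.1.2 _ (diag_mem_box hm))
    fun m _ x y => Finset.sum_eq_zero fun q hq => ?_
  rw [Finset.mem_filter] at hq
  rw [(mem_supported_iff.1 hε.2).2 q.1, LinearMap.zero_apply, zero_mul]
  · exact fun h => hq.2 ⟨0, h.trans diag_zero.symm⟩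
  · exact fun h => hq.2 (exists_diag_eq_of_mem_ray h.2)

section symmetry

/-- The dot product of exponents. -/
def dot [Fintype ι] (u v : ι →₀ ℕ) : ℕ := ∑ i, u i * v i

/-- An additive symmetry of the exponents of order dividing `p`, preserving degrees and dot
products. -/
structure Symmetry (ι : Type*) [Fintype ι] (p : ℕ) where
  map : (ι →₀ ℕ) ≃+ (ι →₀ ℕ)
  iterate_map : ∀ v, map^[p] v = v
  degree_map : ∀ v, (map v).degree = v.degree
  dot_map : ∀ u v, dot (map u) (map v) = dot u v

section

variable {ι : Type*} [Fintype ι]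

theorem dot_add (u v w : ι →₀ ℕ) : dot (u + v) w = dot u w + dot v w := by
  simp [dot, add_mul, Finset.sum_add_distrib]

theorem dot_smul (a : ℕ) (u v : ι →₀ ℕ) : dot (a • u) v = a * dot u v := by
  simp [dot, Finset.mul_sum, mul_assoc]

theorem two_mul_dot_le (u v : ι →₀ ℕ) :
    2 * dot u v ≤ dot u u + dot v v ∧ (u ≠ v → 2 * dot u v < dot u u + dot v v) := by
  have hterm : ∀ i, 2 * (u i * v i) ≤ u i * u i + v i * v i := by
    intro i
    zify
    nlinarith [sq_nonneg ((u i : ℤ) - v i)]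
  rw [dot, dot, dot, Finset.mul_sum, ← Finset.sum_add_distrib]
  refine ⟨Finset.sum_le_sum fun i _ => hterm i, fun hne => ?_⟩
  obtain ⟨i, hi⟩ := Finsupp.ne_iff.1 hne
  refine Finset.sum_lt_sum (fun i _ => hterm i) ⟨i, Finset.mem_univ i, ?_⟩
  have : ((u i : ℤ) - v i) ≠ 0 := sub_ne_zero.2 (by exact_mod_cast hi)
  zify
  nlinarith [pow_pos (abs_pos.2 this) 2, sq_abs ((u i : ℤ) - v i)]

namespace Symmetry

variable {p : ℕ} (φ : Symmetry ι p)

/-- The orbit of an exponent. -/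
def orbit (w : ι →₀ ℕ) : Set (ι →₀ ℕ) := {x | ∃ i : ℕ, φ.map^[i] w = x}

variable {φ} {w x : ι →₀ ℕ}

theorem mem_orbit_self : w ∈ φ.orbit w := ⟨0, rfl⟩

theorem map_mem_orbit (hx : x ∈ φ.orbit w) : φ.map x ∈ φ.orbit w := by
  obtain ⟨i, rfl⟩ := hx
  exact ⟨i + 1, Function.iterate_succ_apply' _ _ _⟩

theorem map_symm_mem_orbit (hp : 0 < p) (hx : x ∈ φ.orbit w) :
    φ.map.symm x ∈ φ.orbit w := by
  obtain ⟨i, rfl⟩ := hx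
  refine ⟨p - 1 + i, ?_⟩
  rw [AddEquiv.eq_symm_apply, ← Function.iterate_succ_apply' (φ.map), ← Nat.succ_add,
    Nat.succ_eq_add_one, Nat.sub_add_cancel hp, Function.iterate_add_apply, φ.iterate_map]

theorem symm_iterate_mem_orbit (hp : 0 < p) (i : ℕ) : φ.map.symm^[i] w ∈ φ.orbit w := by
  induction i with
  | zero => exact mem_orbit_self
  | succ i ih =>
    rw [Function.iterate_succ_apply']
    exact map_symm_mem_orbit hp ih

theorem degree_of_mem_orbit (hx : x ∈ φ.orbit w) : x.degree = w.degree := by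
  obtain ⟨i, rfl⟩ := hx
  induction i with
  | zero => rfl
  | succ i ih => rw [Function.iterate_succ_apply', φ.degree_map, ih]

theorem dot_self_of_mem_orbit (hx : x ∈ φ.orbit w) : dot x x = dot w w := by
  obtain ⟨i, rfl⟩ := hx
  induction i with
  | zero => rfl
  | succ i ih => rw [Function.iterate_succ_apply', φ.dot_map, ih]

theorem map_mem_iff_of_forward (hp : 0 < p) {X : Set (ι →₀ ℕ)} (h : ∀ v ∈ X, φ.map v ∈ X)
    (v : ι →₀ ℕ) : φ.map v ∈ X ↔ v ∈ X := by
  refine ⟨fun hv => ?_, h v⟩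
  have key : ∀ i, φ.map^[i] (φ.map v) ∈ X := by
    intro i
    induction i with
    | zero => exact hv
    | succ i ih =>
      rw [Function.iterate_succ_apply']
      exact h _ ih
  have := key (p - 1)
  rwa [← Function.iterate_succ_apply, Nat.succ_eq_add_one, Nat.sub_add_cancel hp,
    φ.iterate_map] at this

theorem symm_iterate_ne (hp : p.Prime) (hw : φ.map w ≠ w) {i : ℕ} (hi0 : 0 < i) (hi : i < p) :
    φ.map.symm^[i] w ≠ w := by
  intro h
  have h1 : φ.map^[i] w = w := by
    conv_lhs => rw [← h]
    exact (Function.LeftInverse.iterate φ.map.apply_symm_apply i) w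
  have h2 : Function.IsPeriodicPt φ.map p w := φ.iterate_map w
  have h3 := Function.IsPeriodicPt.gcd h1 h2
  rw [((Nat.Prime.coprime_iff_not_dvd hp).2
    (Nat.not_dvd_of_pos_of_lt hi0 hi)).symm.gcd_eq_one] at h3
  exact hw h3

/-- The exponents of `S` lying strictly inside the cone spanned by the orbit of `w`. -/
def inner (φ : Symmetry ι p) (S : PosSemigroup ι) (w : ι →₀ ℕ) : PosSemigroup ι where
  carrier := {v | v ∈ S.carrier ∧
    ∀ x ∈ φ.orbit w, dot v x * w.degree < dot w w * v.degree}
  add_mem := fun {u v} hu hv => ⟨S.add_mem hu.1 hv.1, fun x hx => by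
    rw [dot_add, add_mul, map_add, mul_add]
    exact add_lt_add (hu.2 x hx) (hv.2 x hx)⟩
  zero_notMem := fun h => S.zero_notMem h.1

/-- The exponents of `S` lying in the cone spanned by the orbit of `w`. -/
def cone (φ : Symmetry ι p) (S : PosSemigroup ι) (w : ι →₀ ℕ) : PosSemigroup ι where
  carrier := {v | v ∈ S.carrier ∧
    ∀ x ∈ φ.orbit w, dot v x * w.degree ≤ dot w w * v.degree}
  add_mem := fun {u v} hu hv => ⟨S.add_mem hu.1 hv.1, fun x hx => by
    rw [dot_add, add_mul, map_add, mul_add]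
    exact add_le_add (hu.2 x hx) (hv.2 x hx)⟩
  zero_notMem := fun h => S.zero_notMem h.1

theorem inner_subset {S : PosSemigroup ι} : (φ.inner S w).carrier ⊆ S.carrier :=
  fun _ hv => hv.1

theorem cone_subset {S : PosSemigroup ι} : (φ.cone S w).carrier ⊆ S.carrier :=
  fun _ hv => hv.1

theorem inner_add_cone {S : PosSemigroup ι} {u v : ι →₀ ℕ} (hu : u ∈ (φ.inner S w).carrier)
    (hv : v ∈ (φ.cone S w).carrier) : u + v ∈ (φ.inner S w).carrier :=
  ⟨S.add_mem hu.1 hv.1, fun x hx => by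
    rw [dot_add, add_mul, map_add, mul_add]
    exact add_lt_add_of_lt_of_le (hu.2 x hx) (hv.2 x hx)⟩

theorem notMem_inner {S : PosSemigroup ι} (hx : x ∈ φ.orbit w) :
    x ∉ (φ.inner S w).carrier := by
  intro h
  have := h.2 x hx
  rw [dot_self_of_mem_orbit hx, degree_of_mem_orbit hx] at this
  exact lt_irrefl _ this

theorem map_mem_inner (hp : 0 < p) {S : PosSemigroup ι}
    (hS : ∀ v ∈ S.carrier, φ.map v ∈ S.carrier) {v : ι →₀ ℕ}
    (hv : v ∈ (φ.inner S w).carrier) : φ.map v ∈ (φ.inner S w).carrier := by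
  refine ⟨hS v hv.1, fun x hx => ?_⟩
  have := hv.2 _ (map_symm_mem_orbit hp hx)
  rwa [← φ.dot_map, AddEquiv.apply_symm_apply, ← φ.degree_map v] at this

theorem dot_le_of_mem_ray (hx : x ∈ φ.orbit w) (hw : w ≠ 0) {v y : ι →₀ ℕ} (hv : v ∈ ray x)
    (hy : y ∈ φ.orbit w) : dot v y * w.degree ≤ dot w w * v.degree ∧
      (x ≠ y → dot v y * w.degree < dot w w * v.degree) := by
  obtain ⟨a, b, ha, hb, hab⟩ := hv
  have h1 : a * dot v y = b * dot x y := by rw [← dot_smul, hab, dot_smul]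
  have h2 : a * v.degree = b * w.degree := by
    have := congrArg Finsupp.degree hab
    rwa [map_nsmul, map_nsmul, smul_eq_mul, smul_eq_mul, degree_of_mem_orbit hx] at this
  have h3 := two_mul_dot_le x y
  rw [dot_self_of_mem_orbit hx, dot_self_of_mem_orbit hy, ← two_mul] at h3
  have hdeg : 0 < w.degree :=
    Nat.pos_of_ne_zero fun h => hw ((Finsupp.degree_eq_zero_iff _).1 h)
  have e1 : a * (dot v y * w.degree) = b * w.degree * dot x y := by
    rw [← mul_assoc, h1]; ring
  have e2 : a * (dot w w * v.degree) = b * w.degree * dot w w := by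
    rw [mul_left_comm, h2]; ring
  refine ⟨?_, fun hne => ?_⟩
  · refine le_of_mul_le_mul_left (a := a) ?_ ha
    rw [e1, e2]
    exact Nat.mul_le_mul_left _ (by omega)
  · refine lt_of_mul_lt_mul_left (a := a) ?_ ha.le
    rw [e1, e2]
    have := h3.2 hne
    exact Nat.mul_lt_mul_of_pos_left (by omega) (mul_pos hb hdeg)

theorem rayPart_subset_cone {S : PosSemigroup ι} (hw : w ≠ 0) (hx : x ∈ φ.orbit w) :
    (rayPart S x).carrier ⊆ (φ.cone S w).carrier :=
  fun _ hv => ⟨hv.1, fun _ hy => (dot_le_of_mem_ray hx hw hv.2 hy).1⟩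

theorem add_mem_inner {S : PosSemigroup ι} (hw : w ≠ 0) {y : ι →₀ ℕ} (hx : x ∈ φ.orbit w)
    (hy : y ∈ φ.orbit w) (hxy : x ≠ y) {u v : ι →₀ ℕ} (hu : u ∈ (rayPart S x).carrier)
    (hv : v ∈ (rayPart S y).carrier) : u + v ∈ (φ.inner S w).carrier := by
  refine ⟨S.add_mem hu.1 hv.1, fun z hz => ?_⟩
  rw [dot_add, add_mul, map_add, mul_add]
  have h1 := dot_le_of_mem_ray hx hw hu.2 hz
  have h2 := dot_le_of_mem_ray hy hw hv.2 hz
  by_cases hxz : x = z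
  · exact add_lt_add_of_le_of_lt h1.1 (h2.2 (hxz ▸ hxy.symm))
  · exact add_lt_add_of_lt_of_le (h1.2 hxz) h2.1

end Symmetry

end

theorem conj_mem_supported {S T : PosSemigroup ι} {f g : (EndSeries k A ι)ˣ}
    (h : ∀ u ∈ S.carrier, ∀ v ∈ T.carrier, u + v ∈ S.carrier)
    (hf : f ∈ supported k A S) (hg : g ∈ supported k A T) :
    g * f * g⁻¹ ∈ supported k A S := by
  have := mul_mem (commutator_mem_supported_of_add hg hf h (fun u hu v hv => S.add_mem hu hv)
    fun u hu v hv => add_comm v u ▸ h v hv u hu) hf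
  rwa [inv_mul_cancel_right] at this

/-- The cyclic product `β * σ β * ⋯ * σ^(j - 1) β`. -/
def cyclicProd {G : Type*} [Group G] (σ : G →* G) (β : G) : ℕ → G
  | 0 => 1
  | j + 1 => cyclicProd σ β j * σ^[j] β

theorem cyclicProd_mem {G : Type*} [Group G] {σ : G →* G} {β : G} {K : Subgroup G}
    (h : ∀ j, σ^[j] β ∈ K) (j : ℕ) : cyclicProd σ β j ∈ K := by
  induction j with
  | zero => exact one_mem K
  | succ j ih => exact mul_mem ih (h j)

theorem map_cyclicProd_mul_inv_mem {G : Type*} [Group G] {σ : G →* G} {β : G} {p : ℕ}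
    {K N : Subgroup G} (hK : ∀ j, σ^[j] β ∈ K) (hN : ∀ x ∈ K, ∀ y ∈ N, x * y * x⁻¹ ∈ N)
    (hper : σ^[p] β = β) (hcomm : ∀ j < p, β * σ^[j] β * β⁻¹ * (σ^[j] β)⁻¹ ∈ N) :
    σ (cyclicProd σ β p) * (cyclicProd σ β p)⁻¹ ∈ N := by
  have hshift : ∀ j, β * σ (cyclicProd σ β j) = cyclicProd σ β j * σ^[j] β := by
    intro j
    induction j with
    | zero => simp [cyclicProd]
    | succ j ih =>
      rw [cyclicProd, map_mul, ← mul_assoc, ih, ← Function.iterate_succ_apply' σ]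
  have hβ : β ∈ K := hK 0
  have hprod : ∀ j ≤ p, β⁻¹ * cyclicProd σ β j * β * (cyclicProd σ β j)⁻¹ ∈ N := by
    intro j hj
    induction j with
    | zero => simp [cyclicProd]
    | succ j ih =>
      have h1 := hN _ (inv_mem hβ) _ (inv_mem (hcomm j hj))
      have h2 := mul_mem (ih (Nat.le_of_succ_le hj)) (hN _ (cyclicProd_mem hK j) _ h1)
      convert h2 using 1
      simp [cyclicProd, mul_assoc]
  have h := hprod p le_rfl
  have h' := hshift p
  rw [hper] at h'
  rwa [mul_assoc β⁻¹, ← h', inv_mul_cancel_left] at h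

/-- Substitution of exponents along `φ`. -/
noncomputable def act (φ : (ι →₀ ℕ) ≃+ (ι →₀ ℕ)) : EndSeries k A ι →* EndSeries k A ι where
  toFun := reindex φ
  map_one' := by
    ext1 v
    rw [coeff_reindex, coeff_one, coeff_one]
    simp
  map_mul' f g := by
    ext1 v
    rw [coeff_reindex, coeff_mul, coeff_mul]
    symm
    refine Finset.sum_bij' (fun q _ => (φ q.1, φ q.2)) (fun q _ => (φ.symm q.1, φ.symm q.2))
      ?_ ?_ ?_ ?_ ?_
    · intro q hq
      rw [mem_antidiagonal] at hq ⊢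
      rw [← map_add, hq]
    · intro q hq
      rw [mem_antidiagonal] at hq ⊢
      rw [← map_add, hq, AddEquiv.symm_apply_apply]
    · simp
    · simp
    · intros; rfl

/-- The action of `φ` on invertible series. -/
noncomputable def actUnits (φ : (ι →₀ ℕ) ≃+ (ι →₀ ℕ)) : (EndSeries k A ι)ˣ →* (EndSeries k A ι)ˣ :=
  Units.map (act φ)

theorem coeff_actUnits (φ : (ι →₀ ℕ) ≃+ (ι →₀ ℕ)) (f : (EndSeries k A ι)ˣ) (v : ι →₀ ℕ) :
    coeff v (actUnits φ f).val = coeff (φ v) f.val := rfl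

theorem coeff_iterate_actUnits (φ : (ι →₀ ℕ) ≃+ (ι →₀ ℕ)) (f : (EndSeries k A ι)ˣ) (i : ℕ)
    (v : ι →₀ ℕ) : coeff v ((actUnits φ)^[i] f).val = coeff (φ^[i] v) f.val := by
  induction i generalizing v with
  | zero => rfl
  | succ i ih =>
    rw [Function.iterate_succ_apply', coeff_actUnits, ih, ← Function.iterate_succ_apply]

theorem defect_actUnits (φ : (ι →₀ ℕ) ≃+ (ι →₀ ℕ)) (f : (EndSeries k A ι)ˣ) (v : ι →₀ ℕ)
    (x y : A) : defect (actUnits φ f).val v x y = defect f.val (φ v) x y := by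
  rw [defect, defect, coeff_actUnits]
  congr 1
  refine Finset.sum_bij' (fun q _ => (φ q.1, φ q.2)) (fun q _ => (φ.symm q.1, φ.symm q.2))
    ?_ ?_ ?_ ?_ ?_
  · intro q hq
    rw [mem_antidiagonal] at hq ⊢
    rw [← map_add, hq]
  · intro q hq
    rw [mem_antidiagonal] at hq ⊢
    rw [← map_add, hq, AddEquiv.symm_apply_apply]
  · simp
  · simp
  · intros; rfl

theorem actUnits_mem_truncHS {φ : (ι →₀ ℕ) ≃+ (ι →₀ ℕ)} {Δ : LowerSet (ι →₀ ℕ)}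
    (hΔ : ∀ v ∈ Δ, φ v ∈ Δ) {f : (EndSeries k A ι)ˣ} (hf : f ∈ truncHS k A Δ) :
    actUnits φ f ∈ truncHS k A Δ := by
  refine ⟨?_, fun v hv x y => ?_⟩
  · rw [coeff_actUnits, map_zero, hf.1]
  · rw [defect_actUnits, hf.2 _ (hΔ v hv)]

theorem actUnits_mem_supported {φ : (ι →₀ ℕ) ≃+ (ι →₀ ℕ)} {S T : PosSemigroup ι}
    (hST : ∀ v, φ v ∈ S.carrier → v ∈ T.carrier) {f : (EndSeries k A ι)ˣ}
    (hf : f ∈ supported k A S) : actUnits φ f ∈ supported k A T := by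
  rw [mem_supported_iff] at hf ⊢
  refine ⟨?_, fun v hv hvT => ?_⟩
  · rw [coeff_actUnits, map_zero, hf.1]
  · rw [coeff_actUnits]
    exact hf.2 _ (fun h => hv (by simpa using h)) fun h => hvT (hST v h)

theorem Agree.inv {Δ : LowerSet (ι →₀ ℕ)} {f g : (EndSeries k A ι)ˣ}
    (h : Agree Δ f.val g.val) : Agree Δ (f⁻¹).val (g⁻¹).val := by
  rw [← mul_inv_mem_trivialOn, inv_inv]
  exact inv_mul_mem_trivialOn.2 h

/-- `S` together with all nonzero exponents outside `Δ`. -/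
def PosSemigroup.extend (S : PosSemigroup ι) (Δ : LowerSet (ι →₀ ℕ)) : PosSemigroup ι where
  carrier := {v | v ∈ S.carrier ∨ v ≠ 0 ∧ v ∉ Δ}
  add_mem := by
    rintro u v (hu | ⟨hu0, hu⟩) hv
    · rcases hv with hv | ⟨hv0, hv⟩
      · exact Or.inl (S.add_mem hu hv)
      · exact Or.inr ⟨fun h => hv0 (add_eq_zero.1 h).2, fun h => hv (Δ.lower le_add_self h)⟩
    · exact Or.inr ⟨fun h => hu0 (add_eq_zero.1 h).1, fun h => hu (Δ.lower le_self_add h)⟩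
  zero_notMem := by
    rintro (h | h)
    · exact S.zero_notMem h
    · exact h.1 rfl

theorem PosSemigroup.subset_extend {ι : Type*} (S : PosSemigroup ι) (Δ : LowerSet (ι →₀ ℕ)) :
    S.carrier ⊆ (S.extend Δ).carrier := fun _ => Or.inl

theorem PosSemigroup.extend_anti {ι : Type*} (S : PosSemigroup ι) {Δ Δ' : LowerSet (ι →₀ ℕ)}
    (h : Δ' ≤ Δ) :
    (S.extend Δ).carrier ⊆ (S.extend Δ').carrier :=
  fun _ hv => hv.imp id fun hv => ⟨hv.1, fun hm => hv.2 (h hm)⟩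

variable [Fintype ι] {p : ℕ}

theorem iterate_actUnits_mem_truncHS {φ : Symmetry ι p} {Δ : LowerSet (ι →₀ ℕ)}
    (hΔ : ∀ v ∈ Δ, φ.map v ∈ Δ) {f : (EndSeries k A ι)ˣ} (hf : f ∈ truncHS k A Δ) (j : ℕ) :
    (actUnits φ.map)^[j] f ∈ truncHS k A Δ := by
  induction j with
  | zero => exact hf
  | succ j ih =>
    rw [Function.iterate_succ_apply']
    exact actUnits_mem_truncHS hΔ ih

theorem iterate_actUnits_eq (φ : Symmetry ι p) (f : (EndSeries k A ι)ˣ) :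
    (actUnits φ.map)^[p] f = f := by
  refine Units.ext (MvPowerSeries.ext fun v => ?_)
  rw [coeff_iterate_actUnits, φ.iterate_map]

theorem iterate_actUnits_mem_rayPart (hp : 0 < p) {φ : Symmetry ι p} {S : PosSemigroup ι}
    (hS : ∀ v ∈ S.carrier, φ.map v ∈ S.carrier) {w : ι →₀ ℕ} {f : (EndSeries k A ι)ˣ}
    (hf : f ∈ supported k A (rayPart S w)) (j : ℕ) :
    (actUnits φ.map)^[j] f ∈ supported k A (rayPart S (φ.map.symm^[j] w)) := by
  induction j with
  | zero => exact hf
  | succ j ih =>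
    rw [Function.iterate_succ_apply', Function.iterate_succ_apply']
    refine actUnits_mem_supported ?_ ih
    rintro v ⟨hvS, a, b, ha, hb, hab⟩
    refine ⟨(Symmetry.map_mem_iff_of_forward hp hS v).1 hvS, a, b, ha, hb, ?_⟩
    rw [← map_nsmul, ← hab, map_nsmul, AddEquiv.symm_apply_apply]

/-- A defect realised on a ray can be realised by an invariant family, granted the possibility
of correcting families to invariant ones. -/
theorem exists_invariant_defect (hp : p.Prime) (φ : Symmetry ι p) {Δ : LowerSet (ι →₀ ℕ)}
    {S : PosSemigroup ι} (hΔφ : ∀ v ∈ Δ, φ.map v ∈ Δ)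
    (hSφ : ∀ v ∈ S.carrier, φ.map v ∈ S.carrier) {w : ι →₀ ℕ} (hwS : w ∈ S.carrier)
    (hbelow : ∀ v < w, v ∈ Δ) {β : (EndSeries k A ι)ˣ}
    (hβ : β ∈ truncHS k A Δ ⊓ supported k A (rayPart S w))
    (ih : ∀ S₁ : PosSemigroup ι, S₁.carrier ⊆ S.carrier →
      (∀ v ∈ S₁.carrier, φ.map v ∈ S₁.carrier) → ∀ Q ∈ truncHS k A Δ,
      actUnits φ.map Q * Q⁻¹ ∈ supported k A (S₁.extend Δ) →
      ∃ h ∈ truncHS k A Δ ⊓ supported k A S₁,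
        Agree Δ (actUnits φ.map (h * Q)).val (h * Q).val) :
    ∃ R ∈ truncHS k A Δ ⊓ supported k A S, Agree Δ (actUnits φ.map R).val R.val ∧
      ∀ x y, defect R.val w x y = defect β.val w x y := by
  obtain ⟨hβH, hβS⟩ := Subgroup.mem_inf.1 hβ
  have hw0 : w ≠ 0 := fun h => S.zero_notMem (h ▸ hwS)
  by_cases hfix : φ.map w = w
  · refine ⟨β, Subgroup.mem_inf.2 ⟨hβH, supported_rayPart_le S w hβS⟩, fun v _ => ?_,
      fun _ _ => rfl⟩
    have hray : ∀ v ∈ ray w, φ.map v = v := by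
      rintro v ⟨a, b, ha, -, hab⟩
      have h : a • φ.map v = a • v := by rw [← map_nsmul, hab, map_nsmul, hfix]
      ext i
      have := DFunLike.congr_fun h i
      simp only [Finsupp.smul_apply, smul_eq_mul] at this
      exact Nat.eq_of_mul_eq_mul_left ha this
    rw [coeff_actUnits]
    by_cases hv : v ∈ ray w
    · rw [hray v hv]
    · by_cases hv0 : v = 0
      · rw [hv0, map_zero]
      have hv' : φ.map v ∉ ray w := fun h => hv (by
        have := φ.map.injective (hray _ h)
        rwa [this] at h)
      rw [(mem_supported_iff.1 hβS).2 v hv0 fun h => hv h.2,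
        (mem_supported_iff.1 hβS).2 _ (fun h => hv0 (by simpa using h)) fun h => hv' h.2]
  have hiter := iterate_actUnits_mem_rayPart hp.pos hSφ hβS
  have hiterH := iterate_actUnits_mem_truncHS hΔφ hβH
  have horb : ∀ j, φ.map.symm^[j] w ∈ φ.orbit w := Symmetry.symm_iterate_mem_orbit hp.pos
  have hcone : ∀ j, (actUnits φ.map)^[j] β ∈ supported k A (φ.cone S w) := fun j =>
    supported_mono (Symmetry.rayPart_subset_cone hw0 (horb j)) (hiter j)
  have hinner : ∀ u ∈ (φ.inner S w).carrier, ∀ v ∈ (φ.cone S w).carrier,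
      u + v ∈ (φ.inner S w).carrier := fun _ hu _ hv => Symmetry.inner_add_cone hu hv
  have hcyc : actUnits φ.map (cyclicProd (actUnits φ.map) β p) *
      (cyclicProd (actUnits φ.map) β p)⁻¹ ∈ supported k A (φ.inner S w) := by
    refine map_cyclicProd_mul_inv_mem hcone
      (fun x hx y hy => conj_mem_supported hinner hy hx) (iterate_actUnits_eq φ β) ?_
    intro j hj
    rcases Nat.eq_zero_or_pos j with rfl | hj0
    · simp
    refine commutator_mem_supported_of_add hβS (hiter j)
      (fun u hu v hv => hinner u hu v ?_) (fun u hu v hv => hinner u hu v ?_)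
      fun u hu v hv => Symmetry.add_mem_inner hw0 Symmetry.mem_orbit_self (horb j)
        (Symmetry.symm_iterate_ne hp hfix hj0 hj).symm hu hv
    · exact Symmetry.rayPart_subset_cone hw0 Symmetry.mem_orbit_self hv
    · exact Symmetry.rayPart_subset_cone hw0 (horb j) hv
  have hcycH : ∀ j, cyclicProd (actUnits φ.map) β j ∈ truncHS k A Δ := cyclicProd_mem hiterH
  obtain ⟨h, hh, hinv⟩ := ih (φ.inner S w) Symmetry.inner_subset
    (fun _ hv => Symmetry.map_mem_inner hp.pos hSφ hv) _ (hcycH p)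
    (supported_mono (PosSemigroup.subset_extend _ Δ) hcyc)
  obtain ⟨hhH, hhS⟩ := Subgroup.mem_inf.1 hh
  have hzero : ∀ {g : (EndSeries k A ι)ˣ}, g ∈ truncHS k A Δ → ∀ v < w, ∀ x y,
      defect g.val v x y = 0 := fun hg v hv => hg.2 v (hbelow v hv)
  have hdefect : ∀ j < p, ∀ x y,
      defect (cyclicProd (actUnits φ.map) β (j + 1)).val w x y = defect β.val w x y := by
    intro j hj x y
    induction j with
    | zero => simp [cyclicProd]
    | succ j ihj =>
      rw [cyclicProd, Units.val_mul, defect_mul (hcycH _).1 (hiterH _).1 (hzero (hcycH _))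
        (hzero (hiterH _)), ihj (Nat.lt_of_succ_lt hj),
        defect_eq_zero_of_supported (hiter (j + 1)), add_zero]
      intro hmem
      refine Symmetry.symm_iterate_ne hp hfix j.succ_pos hj
        (eq_of_mem_ray_of_degree_eq hmem.2 ?_).symm
      rw [Symmetry.degree_of_mem_orbit (horb _)]
  refine ⟨h * cyclicProd (actUnits φ.map) β p, Subgroup.mem_inf.2 ⟨mul_mem hhH (hcycH p),
    mul_mem (supported_mono Symmetry.inner_subset hhS)
      (supported_mono Symmetry.cone_subset (cyclicProd_mem hcone p))⟩, hinv, fun x y => ?_⟩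
  rw [Units.val_mul, defect_mul hhH.1 (hcycH p).1 (hzero hhH) (hzero (hcycH p)),
    defect_eq_zero_of_supported hhS (Symmetry.notMem_inner Symmetry.mem_orbit_self), zero_add]
  have := hdefect (p - 1) (Nat.sub_lt hp.pos one_pos) x y
  rwa [Nat.sub_add_cancel hp.one_le] at this

open scoped Classical in
/-- A truncated family which is invariant outside `S` can be corrected, by a family supported
in `S`, to an invariant one. -/
theorem exists_invariant_mul (hp : p.Prime) (φ : Symmetry ι p) (N : ℕ) (Δ : LowerSet (ι →₀ ℕ))
    (S : PosSemigroup ι) (hΔ : (Δ : Set (ι →₀ ℕ)).Finite) (hN : (S.carrier ∩ Δ).ncard = N)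
    (hΔφ : ∀ v ∈ Δ, φ.map v ∈ Δ) (hSφ : ∀ v ∈ S.carrier, φ.map v ∈ S.carrier)
    (Q : (EndSeries k A ι)ˣ) (hQ : Q ∈ truncHS k A Δ)
    (hQS : actUnits φ.map Q * Q⁻¹ ∈ supported k A (S.extend Δ)) :
    ∃ h ∈ truncHS k A Δ ⊓ supported k A S,
      Agree Δ (actUnits φ.map (h * Q)).val (h * Q).val := by
  induction N using Nat.strong_induction_on generalizing Δ S Q with
  | _ N ih =>
  have hagree : ∀ Y ∈ supported k A (S.extend Δ),
      (∀ v ∈ S.carrier, v ∈ Δ → coeff v Y.val = 0) → Y ∈ trivialOn k A Δ := by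
    intro Y hY hYS v hv
    rw [mem_supported_iff] at hY
    by_cases hv0 : v = 0
    · rw [hv0, hY.1, coeff_one, if_pos rfl]
    rw [coeff_one, if_neg hv0]
    by_cases hvS : v ∈ S.carrier
    · exact hYS v hvS hv
    · refine hY.2 v hv0 ?_
      rintro (h | h)
      exacts [hvS h, h.2 hv]
  rcases (S.carrier ∩ Δ).eq_empty_or_nonempty with hemp | hne
  · refine ⟨1, one_mem _, ?_⟩
    rw [one_mul]
    exact mul_inv_mem_trivialOn.1 (hagree _ hQS fun v h1 h2 =>
      absurd (show v ∈ S.carrier ∩ Δ from ⟨h1, h2⟩) (by simp [hemp]))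
  have hfin : (S.carrier ∩ Δ).Finite := hΔ.subset Set.inter_subset_right
  obtain ⟨w, ⟨hwS, hwΔ⟩, hwmax⟩ := hfin.exists_maximalFor Finsupp.degree _ hne
  have hmax : ∀ v ∈ S.carrier, v ∈ Δ → v.degree ≤ w.degree := fun v h1 h2 =>
    (le_total v.degree w.degree).elim id (hwmax ⟨h1, h2⟩)
  have horb : ∀ x ∈ φ.orbit w, x ∈ S.carrier ∧ x ∈ Δ := by
    rintro _ ⟨i, rfl⟩
    induction i with
    | zero => exact ⟨hwS, hwΔ⟩
    | succ i ihi =>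
      rw [Function.iterate_succ_apply']
      exact ⟨hSφ _ ihi.1, hΔφ _ ihi.2⟩
  set Δ' := Δ.sdiff (φ.orbit w) with hΔ'
  have hle : Δ' ≤ Δ := fun v hv => (mem_sdiff_iff.1 hv).1
  have hΔ'φ : ∀ v ∈ Δ', φ.map v ∈ Δ' := by
    intro v hv
    obtain ⟨hvΔ, hvO⟩ := mem_sdiff_iff.1 hv
    refine mem_sdiff_iff.2 ⟨hΔφ v hvΔ, fun u hu huv => ?_⟩
    refine hvO _ (Symmetry.map_symm_mem_orbit hp.pos hu) ?_
    obtain ⟨c, hc⟩ := exists_add_of_le huv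
    rw [← φ.map.symm_apply_apply v, hc, map_add]
    exact le_self_add
  have hbelow : ∀ x ∈ φ.orbit w, ∀ v < x, v ∈ Δ' := by
    intro x hx v hv
    refine mem_sdiff_iff.2 ⟨Δ.lower hv.le (horb x hx).2, fun u hu huv => ?_⟩
    have := eq_of_le_of_degree_le (huv.trans hv.le) (by
      rw [Symmetry.degree_of_mem_orbit hx, Symmetry.degree_of_mem_orbit hu])
    exact absurd (this ▸ huv) hv.not_ge
  have hdisj : ∀ x ∈ φ.orbit w, x ∉ Δ' := fun x hx h => (mem_sdiff_iff.1 h).2 x hx le_rfl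
  have hrest : ∀ v ∈ Δ, v ∉ Δ' → v ∈ S.carrier → v ∈ φ.orbit w := by
    intro v hv hv' hvS
    rw [hΔ', mem_sdiff_iff] at hv'
    push Not at hv'
    obtain ⟨u, hu, huv⟩ := hv' hv
    rw [eq_of_le_of_degree_le huv (by
      rw [Symmetry.degree_of_mem_orbit hu]; exact hmax v hvS hv)]
    exact hu
  have hΔ'fin : (Δ' : Set (ι →₀ ℕ)).Finite := hΔ.subset hle
  have hcard : (S.carrier ∩ Δ').ncard < N := by
    rw [← hN]
    refine Set.ncard_lt_ncard ⟨Set.inter_subset_inter_right _ hle, fun h => ?_⟩ hfin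
    exact hdisj w Symmetry.mem_orbit_self (h ⟨hwS, hwΔ⟩).2
  have hQ' : Q ∈ truncHS k A Δ' := truncHS_anti hle hQ
  obtain ⟨h', hh', hinv'⟩ := ih _ hcard Δ' S hΔ'fin rfl hΔ'φ hSφ Q hQ'
    (supported_mono (S.extend_anti hle) hQS)
  have hwbelow := hbelow w Symmetry.mem_orbit_self
  obtain ⟨β, hβ, hβw⟩ := exists_ray_defect_eq hΔ'fin hwS
    (hdisj w Symmetry.mem_orbit_self) hwbelow hh'
  obtain ⟨R₀, hR₀, hR₀inv, hR₀w⟩ := exists_invariant_defect hp φ hΔ'φ hSφ hwS hwbelow hβ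
    fun S₁ hS₁ hS₁φ Q₁ hQ₁ hQ₁S => ih _ ((Set.ncard_le_ncard
      (Set.inter_subset_inter_left _ hS₁) (hΔ'fin.subset Set.inter_subset_right)).trans_lt hcard)
      Δ' S₁ hΔ'fin rfl hΔ'φ hS₁φ Q₁ hQ₁ hQ₁S
  have hzero : ∀ {g : (EndSeries k A ι)ˣ}, g ∈ truncHS k A Δ' → ∀ x ∈ φ.orbit w, ∀ v < x,
      ∀ a b, defect g.val v a b = 0 := fun hg x hx v hv => hg.2 v (hbelow x hx v hv)
  set h₂ := R₀⁻¹ * h' with hh₂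
  have hh₂mem : h₂ ∈ truncHS k A Δ' ⊓ supported k A S := mul_mem (inv_mem hR₀) hh'
  set R₂ := h₂ * Q with hR₂
  have hR₂H : R₂ ∈ truncHS k A Δ' := mul_mem hh₂mem.1 hQ'
  have hR₂inv : Agree Δ' (actUnits φ.map R₂).val R₂.val := by
    have : R₂ = R₀⁻¹ * (h' * Q) := by rw [hR₂, hh₂, mul_assoc]
    rw [this, map_mul, map_inv]
    exact (Agree.inv hR₀inv).mul hinv'
  have hR₂w : ∀ x y, defect R₂.val w x y = 0 := by
    intro x y
    have hz : ∀ {g : (EndSeries k A ι)ˣ}, g ∈ truncHS k A Δ' → ∀ v < w, ∀ a b,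
      defect g.val v a b = 0 := fun hg => hzero hg w Symmetry.mem_orbit_self
    rw [hR₂, Units.val_mul, defect_mul hh₂mem.1.1 hQ.1 (hz hh₂mem.1) (hz hQ'), hQ.2 w hwΔ,
      hh₂, Units.val_mul, defect_mul (inv_mem hR₀).1.1 hh'.1.1 (hz (inv_mem hR₀).1) (hz hh'.1),
      defect_inv hR₀.1.1 (hz hR₀.1), hR₀w, hβw]
    simp
  obtain ⟨z, hz0, hz⟩ := exists_unit_coeff (ι := ι)
    (fun v => if v ∈ φ.orbit w then coeff w R₂.val - coeff v R₂.val else 0)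
  have hzS : z ∈ supported k A S := mem_supported_iff.2 ⟨hz0, fun v hv hvS => by
    rw [hz v hv, if_neg fun h => hvS (horb v h).1]⟩
  have hzΔ' : z ∈ trivialOn k A Δ' := by
    intro v hv
    by_cases hv0 : v = 0
    · rw [hv0, hz0, coeff_one, if_pos rfl]
    · rw [hz v hv0, if_neg fun h => hdisj v h hv, coeff_one, if_neg hv0]
  have hzH : z ∈ truncHS k A Δ' := trivialOn_inf_supported_le Δ' S (Subgroup.mem_inf.2 ⟨hzΔ', hzS⟩)
  set R₃ := z * R₂ with hR₃
  have hR₃R₂ : ∀ v ∈ Δ', coeff v R₃.val = coeff v R₂.val := by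
    intro v hv
    have := Agree.mul hzΔ' (Agree.refl Δ' R₂.val) v hv
    rwa [one_mul, ← Units.val_mul] at this
  have hR₃O : ∀ x ∈ φ.orbit w, coeff x R₃.val = coeff w R₂.val := by
    intro x hx
    have hx0 : x ≠ 0 := fun h => S.zero_notMem (h ▸ (horb x hx).1)
    rw [hR₃, Units.val_mul, coeff_mul_eq_add hx0 hz0 hR₂H.1, hz x hx0, if_pos hx,
      sub_add_cancel]
    intro u v huv hu hv
    left
    rw [hzΔ' u (hbelow x hx u (huv ▸ lt_add_of_pos_right _ (pos_iff_ne_zero.2 hv))),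
      coeff_one, if_neg hu]
  have hR₃inv : ∀ v, v ∈ Δ' ∨ v ∈ φ.orbit w →
      coeff v (actUnits φ.map R₃).val = coeff v R₃.val := by
    rintro v (hv | hv)
    · rw [coeff_actUnits, hR₃R₂ _ (hΔ'φ v hv), hR₃R₂ v hv, ← hR₂inv v hv, coeff_actUnits]
    · rw [coeff_actUnits, hR₃O _ (Symmetry.map_mem_orbit hv), hR₃O v hv]
  have hlower : ∀ v, v ∈ Δ' ∨ v ∈ φ.orbit w → ∀ u ≤ v, u ∈ Δ' ∨ u ∈ φ.orbit w := by
    rintro v (hv | hv) u hu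
    · exact Or.inl (Δ'.lower hu hv)
    · rcases hu.eq_or_lt with rfl | hu
      · exact Or.inr hv
      · exact Or.inl (hbelow v hv u hu)
  have hR₃def : ∀ x ∈ φ.orbit w, ∀ a b, defect R₃.val x a b = 0 := by
    rintro _ ⟨i, rfl⟩ a b
    induction i with
    | zero =>
      change defect R₃.val w a b = 0
      rw [defect_congr (g := R₂.val), hR₂w]
      intro v hv
      rcases hv.eq_or_lt with rfl | hv
      · exact hR₃O v Symmetry.mem_orbit_self
      · exact hR₃R₂ v (hwbelow v hv)
    | succ i ihi =>
      rw [Function.iterate_succ_apply', ← defect_actUnits,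
        defect_congr fun v hv => hR₃inv v (hlower _ (Or.inr ⟨i, rfl⟩) v hv), ihi]
  have hh₃ : z * h₂ ∈ truncHS k A Δ' := mul_mem hzH hh₂mem.1
  have hh₃S : z * h₂ ∈ supported k A S := mul_mem hzS hh₂mem.2
  have hR₃eq : R₃ = z * h₂ * Q := (mul_assoc z h₂ Q).symm
  refine ⟨z * h₂, Subgroup.mem_inf.2 ⟨mem_truncHS_of_defect hh₃ hh₃S ?_, hh₃S⟩, ?_⟩
  · intro v hv hv' hvS x y
    have hvO := hrest v hv hv' hvS
    have := hR₃def v hvO x y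
    rwa [hR₃eq, Units.val_mul, defect_mul hh₃.1 hQ.1 (hzero hh₃ v hvO) (hzero hQ' v hvO),
      hQ.2 v hv, add_zero] at this
  rw [← hR₃eq, ← mul_inv_mem_trivialOn]
  refine hagree _ ?_ fun v hvS hv => ?_
  · have hext : supported k A S ≤ supported k A (S.extend Δ) :=
      supported_mono (S.subset_extend Δ)
    have hσ : actUnits φ.map (z * h₂) ∈ supported k A S :=
      actUnits_mem_supported (fun v => (Symmetry.map_mem_iff_of_forward hp.pos hSφ v).1) hh₃S
    have := mul_mem (mul_mem (hext hσ) hQS) (inv_mem (hext hh₃S))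
    convert this using 1
    rw [hR₃eq, map_mul _ _ Q]
    group
  · have hgood : v ∈ Δ' ∨ v ∈ φ.orbit w := by
      by_cases h : v ∈ Δ'
      · exact Or.inl h
      · exact Or.inr (hrest v hv h hvS)
    have : Agree (LowerSet.Iic v) (actUnits φ.map R₃).val R₃.val :=
      fun u hu => hR₃inv u (hlower v hgood u hu)
    rw [mul_inv_mem_trivialOn.2 this v (LowerSet.mem_Iic_iff.2 le_rfl), coeff_one, if_neg]
    exact fun h => S.zero_notMem (h ▸ hvS)

end symmetry

theorem sum_eq_zero_of_periodic {α M : Type*} [AddCommMonoid M] {p : ℕ} [Fact p.Prime]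
    (hM : ∀ a : M, p • a = 0) (s : Finset α) (F : α → M) (g : α → α) (hg : ∀ a ∈ s, g a ∈ s)
    (hper : ∀ a ∈ s, g^[p] a = a) (hfree : ∀ a ∈ s, g a ≠ a) (hF : ∀ a ∈ s, F (g a) = F a) :
    ∑ a ∈ s, F a = 0 := by
  classical
  rw [Finset.sum_comp (fun b => b) F]
  refine Finset.sum_eq_zero fun b _ => ?_
  let G : Function.End (s.filter fun a => F a = b) := fun a =>
    ⟨g a, Finset.mem_filter.2 ⟨hg _ (Finset.mem_filter.1 a.2).1,
      (hF _ (Finset.mem_filter.1 a.2).1).trans (Finset.mem_filter.1 a.2).2⟩⟩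
  have hiter : ∀ i a, ((G ^ i) a : α) = g^[i] a := by
    intro i
    induction i with
    | zero => exact fun a => rfl
    | succ i ih =>
      intro a
      rw [pow_succ']
      change g ((G ^ i) a : α) = _
      rw [ih, Function.iterate_succ_apply']
  have hG : G ^ p ^ 1 = 1 := by
    rw [pow_one]
    funext a
    exact Subtype.ext ((hiter p a).trans (hper _ (Finset.mem_filter.1 a.2).1))
  have hcard := Equiv.Perm.card_fixedPoints_modEq hG
  have hempty : IsEmpty (Function.fixedPoints G) :=
    ⟨fun a => hfree _ (Finset.mem_filter.1 a.1.2).1 (congrArg Subtype.val a.2)⟩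
  rw [Fintype.card_eq_zero (α := Function.fixedPoints G), Nat.modEq_zero_iff_dvd,
    Fintype.card_coe] at hcard
  obtain ⟨c, hc⟩ := hcard
  rw [hc, mul_smul, hM]

section shift

variable {p : ℕ} [Fact p.Prime]

/-- The cyclic shift of exponents. -/
noncomputable def shiftMap (p : ℕ) : (ZMod p →₀ ℕ) ≃+ (ZMod p →₀ ℕ) :=
  Finsupp.domCongr (Equiv.subRight 1)

theorem shiftMap_apply (v : ZMod p →₀ ℕ) (a : ZMod p) : shiftMap p v a = v (a + 1) := rfl

theorem iterate_shiftMap_apply (j : ℕ) (v : ZMod p →₀ ℕ) (a : ZMod p) :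
    (shiftMap p)^[j] v a = v (a + j) := by
  induction j generalizing a with
  | zero => simp
  | succ j ih =>
    rw [Function.iterate_succ_apply', shiftMap_apply, ih, Nat.cast_succ, add_assoc, add_comm 1]

/-- The cyclic shift as a symmetry. -/
noncomputable def shift (p : ℕ) [Fact p.Prime] : Symmetry (ZMod p) p where
  map := shiftMap p
  iterate_map v := Finsupp.ext fun a => by
    rw [iterate_shiftMap_apply, CharP.cast_eq_zero, add_zero]
  degree_map v := by
    rw [Finsupp.degree_eq_sum, Finsupp.degree_eq_sum]
    exact Equiv.sum_comp (Equiv.addRight 1) fun a => v a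
  dot_map u v := Equiv.sum_comp (Equiv.addRight 1) fun a => u a * v a

theorem exists_diag_eq_of_shiftMap_eq {v : ZMod p →₀ ℕ} (h : shiftMap p v = v) :
    ∃ m, v = diag (ZMod p) m := by
  refine ⟨v 0, Finsupp.ext fun a => ?_⟩
  have := DFunLike.congr_fun (Function.iterate_fixed h a.val) 0
  rw [iterate_shiftMap_apply, zero_add, ZMod.natCast_zmod_val] at this
  rw [this, diag_apply]

theorem shiftMap_diag (m : ℕ) : shiftMap p (diag (ZMod p) m) = diag (ZMod p) m :=
  Finsupp.ext fun _ => rfl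

/-- The exponents with an entry greater than one. -/
def notSquarefree (ι : Type*) : PosSemigroup ι where
  carrier := {v | ∃ i, 1 < v i}
  add_mem := by
    rintro u v ⟨i, hi⟩ -
    exact ⟨i, hi.trans_le (Nat.le_add_right _ _)⟩
  zero_notMem := by simp

theorem add_mem_notSquarefree {ι : Type*} {u : ι →₀ ℕ} (hu : u ∈ (notSquarefree ι).carrier)
    (v : ι →₀ ℕ) : u + v ∈ (notSquarefree ι).carrier := by
  obtain ⟨i, hi⟩ := hu
  exact ⟨i, hi.trans_le (Nat.le_add_right _ _)⟩

/-- All nonzero exponents. -/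
def nonzero (ι : Type*) : PosSemigroup ι where
  carrier := {v | v ≠ 0}
  add_mem := fun hu _ h => hu (add_eq_zero.1 h).1
  zero_notMem := fun h => h rfl

theorem mem_supported_nonzero {f : (EndSeries k A ι)ˣ} (hf : coeff 0 f.val = 1) :
    f ∈ supported k A (nonzero ι) :=
  mem_supported_iff.2 ⟨hf, fun _ hv hv' => absurd hv hv'⟩

theorem coeff_mul_comm_of_commute {f g : EndSeries k A ι} {v : ι →₀ ℕ}
    (h : ∀ u w, u + w = v → Commute (coeff u f) (coeff w g)) :
    coeff v (f * g) = coeff v (g * f) := by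
  rw [coeff_mul, coeff_mul]
  refine Finset.sum_nbij' Prod.swap Prod.swap ?_ ?_ (fun _ _ => rfl) (fun _ _ => rfl)
    fun q hq => (h _ _ (mem_antidiagonal.1 hq)).eq
  all_goals
    intro q hq
    rw [mem_antidiagonal] at hq ⊢
    exact (add_comm _ _).trans hq

/-- The exponent with entries one in the first `j` places and zero elsewhere. -/
noncomputable def initialOnes (p : ℕ) [Fact p.Prime] (j : ℕ) : ZMod p →₀ ℕ :=
  Finsupp.equivFunOnFinite.symm fun i => if i.val < j then 1 else 0

theorem initialOnes_apply (j : ℕ) (i : ZMod p) :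
    initialOnes p j i = if i.val < j then 1 else 0 := rfl

theorem initialOnes_succ {j : ℕ} (hj : j < p) :
    initialOnes p (j + 1) = initialOnes p j + Finsupp.single (j : ZMod p) 1 := by
  ext i
  have hiff : (j : ZMod p) = i ↔ i.val = j := by
    constructor
    · rintro rfl
      exact ZMod.val_cast_of_lt hj
    · rintro rfl
      exact ZMod.natCast_zmod_val i
  rw [Finsupp.add_apply, initialOnes_apply, initialOnes_apply, Finsupp.single_apply]
  simp only [hiff]
  split_ifs <;> omega

theorem initialOnes_self : initialOnes p p = diag (ZMod p) 1 :=
  Finsupp.ext fun i => if_pos (ZMod.val_lt i)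

theorem coeff_iterate_eq_zero {f : (EndSeries k A (ZMod p))ˣ}
    (hf : f ∈ supported k A (axis (0 : ZMod p))) {j : ℕ} {v : ZMod p →₀ ℕ} {i : ZMod p}
    (hij : i ≠ j) (hv : v i ≠ 0) : coeff v ((actUnits (shiftMap p))^[j] f).val = 0 := by
  have hvi : (shiftMap p)^[j] v (i - j) ≠ 0 := by
    rwa [iterate_shiftMap_apply, sub_add_cancel]
  rw [coeff_iterate_actUnits]
  refine (mem_supported_iff.1 hf).2 _ (fun h => hvi (by rw [h, Finsupp.zero_apply])) fun h => ?_
  rw [h.2, Finsupp.single_apply, if_neg (sub_ne_zero.2 hij).symm] at hvi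
  exact hvi rfl

theorem coeff_cyclicProd_eq_zero {f : (EndSeries k A (ZMod p))ˣ}
    (hf : f ∈ supported k A (axis (0 : ZMod p))) {j : ℕ} (hj : j ≤ p) {v : ZMod p →₀ ℕ}
    {i : ZMod p} (hi : j ≤ i.val) (hv : v i ≠ 0) :
    coeff v (cyclicProd (actUnits (shiftMap p)) f j).val = 0 := by
  induction j generalizing v with
  | zero =>
    rw [cyclicProd, Units.val_one, coeff_one, if_neg]
    rintro rfl
    exact hv rfl
  | succ j ih =>
    rw [cyclicProd, Units.val_mul, coeff_mul]
    refine Finset.sum_eq_zero fun q hq => ?_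
    rw [mem_antidiagonal] at hq
    by_cases h1 : q.1 i = 0
    · rw [coeff_iterate_eq_zero hf (v := q.2) (i := i), mul_zero]
      · rintro rfl
        rw [ZMod.val_cast_of_lt hj] at hi
        omega
      · rw [← hq, Finsupp.add_apply, h1, zero_add] at hv
        exact hv
    · rw [ih (Nat.le_of_succ_le hj) (Nat.le_of_succ_le hi) h1, zero_mul]

theorem coeff_cyclicProd_initialOnes {f : (EndSeries k A (ZMod p))ˣ}
    (hf : f ∈ supported k A (axis (0 : ZMod p))) {j : ℕ} (hj : j ≤ p) :
    coeff (initialOnes p j) (cyclicProd (actUnits (shiftMap p)) f j).val =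
      coeff (Finsupp.single 0 1) f.val ^ j := by
  induction j with
  | zero =>
    have : initialOnes p 0 = 0 := Finsupp.ext fun i => by simp [initialOnes_apply]
    rw [this, cyclicProd, Units.val_one, coeff_one, if_pos rfl, pow_zero]
  | succ j ih =>
    have hjval : ((j : ZMod p)).val = j := ZMod.val_cast_of_lt hj
    rw [cyclicProd, Units.val_mul, coeff_mul,
      Finset.sum_eq_single (initialOnes p j, Finsupp.single (j : ZMod p) 1),
      ih (Nat.le_of_succ_le hj), pow_succ, coeff_iterate_actUnits]
    · congr 2
      have : (shiftMap p)^[j] (Finsupp.single (j : ZMod p) 1) = Finsupp.single 0 1 := by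
        ext a
        rw [iterate_shiftMap_apply, Finsupp.single_apply, Finsupp.single_apply]
        simp [eq_comm]
      rw [this]
    · rintro ⟨u, v⟩ huv hne
      rw [mem_antidiagonal] at huv
      dsimp only at huv ⊢
      by_cases hu : u j = 0
      · by_cases hv : v = Finsupp.single (j : ZMod p) (v j)
        · refine absurd ?_ hne
          have hvj := DFunLike.congr_fun huv (j : ZMod p)
          rw [Finsupp.add_apply, hu, zero_add, initialOnes_apply, hjval, if_pos j.lt_succ_self]
            at hvj
          rw [hvj] at hv
          rw [initialOnes_succ hj, hv] at huv
          rw [add_right_cancel huv, hv]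
        · obtain ⟨i, hi⟩ := Finsupp.ne_iff.1 hv
          have hij : i ≠ j := by
            rintro rfl
            simp at hi
          rw [Finsupp.single_apply, if_neg hij.symm] at hi
          rw [coeff_iterate_eq_zero hf hij hi, mul_zero]
      · rw [coeff_cyclicProd_eq_zero hf (Nat.le_of_succ_le hj) hjval.ge hu, zero_mul]
    · intro h
      exact absurd (mem_antidiagonal.2 (initialOnes_succ hj).symm) h

open scoped Classical in
theorem isFinIntegrable_pow [CharP k p] {n : ℕ} {D : A →ₗ[k] A}
    (hD : IsFinIntegrable k A 1 n D) : IsFinIntegrable k A 1 n (D ^ p) := by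
  have hp : p.Prime := Fact.out
  obtain ⟨α, hα0, -, rfl, hα⟩ := hD
  obtain ⟨f, hf, hfc⟩ := exists_axis_series (k := k) (A := A) (0 : ZMod p) hα0 hα
  obtain ⟨hf, hfS⟩ := Subgroup.mem_inf.1 hf
  have hbox : ∀ v ∈ box (ZMod p) n, shiftMap p v ∈ box (ZMod p) n := fun v hv a => hv (a + 1)
  have hiterH : ∀ j, (actUnits (shiftMap p))^[j] f ∈ truncHS k A (box (ZMod p) n) :=
    iterate_actUnits_mem_truncHS (φ := shift p) hbox hf
  set P := cyclicProd (actUnits (shiftMap p)) f p with hP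
  have hPH : P ∈ truncHS k A (box (ZMod p) n) := cyclicProd_mem hiterH p
  have hvalue : ∀ v : ZMod p →₀ ℕ, (∀ i, v i ≤ 1) →
      coeff v f.val = 0 ∨ coeff v f.val = 1 ∨ coeff v f.val = α 1 := by
    intro v hv
    by_cases h : v = Finsupp.single 0 (v 0)
    · rw [h, hfc]
      have : v 0 = 0 ∨ v 0 = 1 := by have := hv 0; omega
      rcases this with h0 | h0 <;> rw [h0]
      · exact Or.inr (Or.inl hα0)
      · exact Or.inr (Or.inr rfl)
    · exact Or.inl ((mem_supported_iff.1 hfS).2 v (by rintro rfl; simp at h) fun h' => h h'.2)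
  have habsorb : ∀ u ∈ (notSquarefree (ZMod p)).carrier, ∀ v ∈ (nonzero (ZMod p)).carrier,
      u + v ∈ (notSquarefree (ZMod p)).carrier := fun _ hu v _ => add_mem_notSquarefree hu v
  have hiterK : ∀ j, (actUnits (shiftMap p))^[j] f ∈ supported k A (nonzero (ZMod p)) :=
    fun j => mem_supported_nonzero (hiterH j).1
  have hcyc : actUnits (shiftMap p) P * P⁻¹ ∈ supported k A (notSquarefree (ZMod p)) := by
    refine map_cyclicProd_mul_inv_mem hiterK
      (fun x hx y hy => conj_mem_supported habsorb hy hx) (iterate_actUnits_eq (shift p) f) ?_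
    intro j _
    refine commutator_mem_supported (hiterK 0) (hiterK j) habsorb habsorb fun v hv => ?_
    have hv1 : ∀ i, v i ≤ 1 := fun i => not_lt.1 fun h => hv ⟨i, h⟩
    rw [map_sub, Units.val_mul, Units.val_mul, coeff_mul_comm_of_commute, sub_self]
    intro u w huw
    rw [coeff_iterate_actUnits]
    have hu := hvalue u fun i => (Nat.le_add_right _ _).trans (by
      rw [← Finsupp.add_apply, huw]; exact hv1 i)
    have hw := hvalue ((shiftMap p)^[j] w) fun i => by
      rw [iterate_shiftMap_apply]
      exact (Nat.le_add_left _ _).trans (by rw [← Finsupp.add_apply, huw]; exact hv1 _)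
    change Commute (coeff u f.val) _
    rcases hu with hu | hu | hu <;> rcases hw with hw | hw | hw <;> rw [hu, hw] <;> simp
  obtain ⟨h, hh, hinv⟩ := exists_invariant_mul hp (shift p) _ (box (ZMod p) n)
    (notSquarefree (ZMod p)) (finite_box _ n) rfl hbox
    (fun v ⟨i, hi⟩ => ⟨i - 1, by
      change 1 < shiftMap p v (i - 1)
      rwa [shiftMap_apply, sub_add_cancel]⟩) P hPH
    (supported_mono (PosSemigroup.subset_extend _ _) hcyc)
  obtain ⟨hhH, hhS⟩ := Subgroup.mem_inf.1 hh
  have hQH : h * P ∈ truncHS k A (box (ZMod p) n) := mul_mem hhH hPH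
  have hd0 : diag (ZMod p) 1 ≠ 0 := fun h => by simpa using DFunLike.congr_fun h 0
  have hsmall : ∀ u ≤ diag (ZMod p) 1, u ≠ 0 → coeff u h.val = 0 := fun u hu hu0 =>
    (mem_supported_iff.1 hhS).2 u hu0 fun ⟨i, hi⟩ => hi.not_ge (hu i)
  have hcoeff : coeff (diag (ZMod p) 1) (h * P).val = α 1 ^ p := by
    rw [Units.val_mul, coeff_mul_eq_add hd0 hhH.1 hPH.1, hsmall _ le_rfl hd0, zero_add,
      ← initialOnes_self, hP, coeff_cyclicProd_initialOnes hfS le_rfl, hfc]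
    exact fun u v huv hu _ => Or.inl (hsmall u (huv ▸ le_self_add) hu)
  rw [← hcoeff]
  refine isFinIntegrable_of_diag hQH.1 (fun m hm => hQH.2 _ (diag_mem_box hm))
    fun m hm x y => ?_
  have hshift : ∀ v ∈ box (ZMod p) n,
      coeff (shiftMap p v) (h * P).val = coeff v (h * P).val := fun v hv => hinv v hv
  refine sum_eq_zero_of_periodic (p := p) (fun a => ?_) _ _
    (Prod.map (shiftMap p) (shiftMap p)) ?_ ?_ ?_ ?_
  · rw [← Nat.cast_smul_eq_nsmul k, CharP.cast_eq_zero, zero_smul]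
  all_goals
    rintro ⟨u, v⟩ huv
    rw [Finset.mem_filter, mem_antidiagonal] at huv
    obtain ⟨huv, hu⟩ := huv
    dsimp only at huv hu
  · rw [Finset.mem_filter, mem_antidiagonal]
    refine ⟨?_, ?_⟩
    · rw [Prod.map_fst, Prod.map_snd, ← map_add, huv, shiftMap_diag]
    · rintro ⟨j, hj⟩
      exact hu ⟨j, (shiftMap p).injective (hj.trans (shiftMap_diag j).symm)⟩
  · rw [Prod.map_iterate]
    exact Prod.ext ((shift p).iterate_map u) ((shift p).iterate_map v)
  · exact fun h => hu (exists_diag_eq_of_shiftMap_eq (Prod.ext_iff.1 h).1)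
  · have hm' := diag_mem_box (ι := ZMod p) hm
    rw [Prod.map_fst, Prod.map_snd, hshift u ((box _ n).lower (huv ▸ le_self_add) hm'),
      hshift v ((box _ n).lower (huv ▸ le_add_self) hm')]

end shift

end HasseSchmidt

/-- For a Noether algebra `A` over a commutative Noetherian ring `k` and `n > 1`,
the `[1,n)`-integrable derivations are closed under the commutator bracket, and
(when `k` is a field of characteristic `p > 0`) under `p`-th powers: thus
`Der_{[1,n)}(A)` is a Lie subalgebra (and, in characteristic `p`, a restricted
Lie subalgebra) of `Der(A)`. -/
theorem statement10 (k : Type*) [CommRing k] [IsNoetherianRing k]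
    (A : Type*) [Ring A] [Algebra k A] [Module.Finite k A]
    (n : ℕ) (hn : 1 < n) :
    (∀ D D' : A →ₗ[k] A, IsDerivation k A D → IsDerivation k A D' →
      IsFinIntegrable k A 1 n D → IsFinIntegrable k A 1 n D' →
      IsFinIntegrable k A 1 n (D ∘ₗ D' - D' ∘ₗ D)) ∧
    (∀ p : ℕ, 0 < p → IsField k → CharP k p →
      ∀ D : A →ₗ[k] A, IsDerivation k A D → IsFinIntegrable k A 1 n D →
        IsFinIntegrable k A 1 n (D ^ p)) := by
  refine ⟨fun D D' _ _ hD hD' => HasseSchmidt.isFinIntegrable_commutator hn hD hD',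
    fun p hp hk _ D _ hD => ?_⟩
  have := hk.isDomain
  have : Fact p.Prime := ⟨(CharP.char_is_prime_or_zero k p).resolve_right hp.ne'⟩
  exact HasseSchmidt.isFinIntegrable_pow hD
end

section
/- Let k be a commutative ring, A an associative unital k-algebra, and let α_0 = id_A, α_1, …, α_{n−1} : A → A be k-linear maps satisfying α_i(xy) = Σ_{j=0}^{i} α_j(x)α_{i−j}(y) for all 0 ≤ i ≤ n−1 and all x, y ∈ A. Then the k-bilinear map f : A × A → A defined by f(x,y) = Σ_{i=1}^{n−1} α_i(x)α_{n−i}(y) is a Hochschild 2-cocycle; that is, for all x, y, z ∈ A: x·f(y,z) − f(xy,z) + f(x,yz) − f(x,y)·z = 0. -/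
/-- Given a truncated Hasse–Schmidt family `α_0 = id, α_1, …, α_{n-1}`
(i.e. an automorphism `1 + α_1 t + ⋯ + α_{n-1} t^{n-1}` of `A[t]/(t^n)`),
the obstruction cochain `f(x,y) = Σ_{i=1}^{n-1} α_i(x) α_{n-i}(y)` is a
Hochschild 2-cocycle. -/
theorem statement11 (k A : Type*) [CommRing k] [Ring A] [Algebra k A]
    (n : ℕ) (α : ℕ → (A →ₗ[k] A))
    (h0 : α 0 = LinearMap.id)
    (hconv : ∀ i, i < n → ∀ x y : A,
      α i (x * y) = ∑ j ∈ Finset.range (i + 1), α j x * α (i - j) y) :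
    ∀ x y z : A,
      x * (∑ i ∈ Finset.Ico 1 n, α i y * α (n - i) z)
        - (∑ i ∈ Finset.Ico 1 n, α i (x * y) * α (n - i) z)
        + (∑ i ∈ Finset.Ico 1 n, α i x * α (n - i) (y * z))
        - (∑ i ∈ Finset.Ico 1 n, α i x * α (n - i) y) * z = 0 := by
  intro x y z
  have hleft : ∑ i ∈ Finset.Ico 1 n, α i (x * y) * α (n - i) z =
      x * (∑ i ∈ Finset.Ico 1 n, α i y * α (n - i) z) +
        ∑ i ∈ Finset.Ico 1 n, ∑ j ∈ Finset.Ico 1 (i + 1),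
          α j x * α (i - j) y * α (n - i) z := by
    rw [Finset.mul_sum, ← Finset.sum_add_distrib]
    refine Finset.sum_congr rfl fun i hi => ?_
    rw [hconv i (Finset.mem_Ico.mp hi).2, Finset.range_eq_Ico,
      Finset.sum_eq_sum_Ico_succ_bot i.succ_pos, add_mul, Finset.sum_mul]
    simp [h0, mul_assoc]
  have hright : ∑ i ∈ Finset.Ico 1 n, α i x * α (n - i) (y * z) =
      (∑ i ∈ Finset.Ico 1 n, ∑ j ∈ Finset.Ico i n,
          α i x * α (j - i) y * α (n - j) z) +
        (∑ i ∈ Finset.Ico 1 n, α i x * α (n - i) y) * z := by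
    rw [Finset.sum_mul, ← Finset.sum_add_distrib]
    refine Finset.sum_congr rfl fun i hi => ?_
    obtain ⟨hi1, hin⟩ := Finset.mem_Ico.mp hi
    rw [hconv (n - i) (by omega), Finset.sum_range_succ, mul_add, Finset.mul_sum,
      Finset.sum_Ico_eq_sum_range]
    simp [h0, mul_assoc, Nat.sub_sub]
  rw [hleft, hright, Finset.sum_Ico_Ico_comm]
  abel
end

section
/- Let p be a prime and n a nonnegative integer. The number of parts of length divisible by p in all partitions of n, counted without multiplicity (i.e. Σ over partitions λ of n of the number of distinct part-sizes of λ that are divisible by p), equals the number of parts of length exactly p in all partitions of n, counted with multiplicity (i.e. Σ over partitions λ of n of the multiplicity of p as a part of λ). -/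
namespace Nat.Partition

/-- Exchange a submultiset `s` of the parts of a partition for a multiset `t` of positive
integers with the same sum. -/
def exchange {n : ℕ} {s t : Multiset ℕ} (ht : ∀ i ∈ t, 0 < i) (hst : s.sum = t.sum)
    (μ : n.Partition) (hμ : s ≤ μ.parts) : n.Partition where
  parts := μ.parts - s + t
  parts_pos {i} hi := (Multiset.mem_add.1 hi).elim
    (fun h => μ.parts_pos (Multiset.mem_of_le (Multiset.sub_le_self _ _) h)) (ht i)
  parts_sum := by
    rw [Multiset.sum_add, ← hst, ← Multiset.sum_add, tsub_add_cancel_of_le hμ, μ.parts_sum]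

/-- The number of partitions of `n` whose parts contain a given multiset of positive integers
depends only on the sum of that multiset. -/
theorem card_filter_le_parts_eq {n : ℕ} {s t : Multiset ℕ} (hs : ∀ i ∈ s, 0 < i)
    (ht : ∀ i ∈ t, 0 < i) (hst : s.sum = t.sum) :
    (Finset.univ.filter fun μ : n.Partition => s ≤ μ.parts).card
      = (Finset.univ.filter fun μ : n.Partition => t ≤ μ.parts).card := by
  refine Finset.card_bij' (fun μ hμ => exchange ht hst μ (Finset.mem_filter.1 hμ).2)
    (fun μ hμ => exchange hs hst.symm μ (Finset.mem_filter.1 hμ).2) ?_ ?_ ?_ ?_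
  · intro μ _
    simp [exchange]
  · intro μ _
    simp [exchange]
  · intro μ hμ
    ext1
    simp [exchange, tsub_add_cancel_of_le (Finset.mem_filter.1 hμ).2]
  · intro μ hμ
    ext1
    simp [exchange, tsub_add_cancel_of_le (Finset.mem_filter.1 hμ).2]

/-- The distinct parts divisible by `p` correspond to the `k ∈ [1, n]` such that `k * p` is
a part. -/
theorem card_filter_dvd_parts {n p : ℕ} (hp : 0 < p) (μ : n.Partition) :
    (μ.parts.toFinset.filter (fun i => p ∣ i)).card
      = ((Finset.Icc 1 n).filter fun k => k * p ∈ μ.parts).card := by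
  symm
  refine Finset.card_bij (fun k _ => k * p) ?_ ?_ ?_
  · intro k hk
    simpa using (Finset.mem_filter.1 hk).2
  · intro a _ b _ h
    exact Nat.eq_of_mul_eq_mul_right hp h
  · intro i hi
    obtain ⟨hi, k, rfl⟩ := Finset.mem_filter.1 hi
    rw [Multiset.mem_toFinset] at hi
    have hk : 0 < k := Nat.pos_of_mul_pos_left (μ.parts_pos hi)
    have hkn : k ≤ n := (Nat.le_mul_of_pos_left k hp).trans (le_of_mem_parts hi)
    exact ⟨k, by simp [mul_comm k p, hi, hkn, Nat.one_le_iff_ne_zero, hk.ne'], mul_comm _ _⟩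

/-- The multiplicity of a positive `p` in a partition of `n` is the number of `k ∈ [1, n]` not
exceeding that multiplicity. -/
theorem count_parts_eq_card_filter {n p : ℕ} (hp : 0 < p) (μ : n.Partition) :
    μ.parts.count p = ((Finset.Icc 1 n).filter fun k => k ≤ μ.parts.count p).card := by
  have hle : μ.parts.count p ≤ n := by
    obtain ⟨u, hu⟩ := Multiset.le_iff_exists_add.1
      (Multiset.le_count_iff_replicate_le.1 (le_refl (μ.parts.count p)))
    have hsum := congrArg Multiset.sum hu
    rw [μ.parts_sum, Multiset.sum_add, Multiset.sum_replicate, smul_eq_mul] at hsum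
    have := Nat.le_mul_of_pos_right (μ.parts.count p) hp
    omega
  have : ((Finset.Icc 1 n).filter fun k => k ≤ μ.parts.count p)
      = Finset.Icc 1 (μ.parts.count p) := by
    ext k
    simp only [Finset.mem_filter, Finset.mem_Icc]
    omega
  simp [this]

end Nat.Partition

/-- The number of parts of length divisible by `p` in all partitions of `n`,
counted without multiplicity (i.e. distinct part-sizes divisible by `p` are
counted once per partition), equals the number of parts of length exactly `p`
in all partitions of `n`, counted with multiplicity. -/
theorem statement16 (p n : ℕ) (hp : p.Prime) :
    ∑ μ : Nat.Partition n, (μ.parts.toFinset.filter (fun i => p ∣ i)).card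
      = ∑ μ : Nat.Partition n, μ.parts.count p := by
  rw [Finset.sum_congr rfl fun μ _ => Nat.Partition.card_filter_dvd_parts hp.pos μ,
    Finset.sum_congr rfl fun μ _ => Nat.Partition.count_parts_eq_card_filter hp.pos μ]
  refine (Finset.sum_card_bipartiteAbove_eq_sum_card_bipartiteBelow
    (fun (μ : Nat.Partition n) k => k * p ∈ μ.parts)).trans (Eq.trans ?_
    (Finset.sum_card_bipartiteAbove_eq_sum_card_bipartiteBelow
    (fun (μ : Nat.Partition n) k => k ≤ μ.parts.count p)).symm)
  refine Finset.sum_congr rfl fun k hk => ?_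
  have hk : 0 < k := (Finset.mem_Icc.1 hk).1
  have h := Nat.Partition.card_filter_le_parts_eq (n := n) (s := {k * p})
    (t := Multiset.replicate k p) (by simp [hk, hp.pos])
    (fun i hi => Multiset.eq_of_mem_replicate hi ▸ hp.pos) (by simp)
  simpa only [Finset.bipartiteBelow, Multiset.singleton_le,
    ← Multiset.le_count_iff_replicate_le] using h
end

section
/- Let n be a nonnegative integer. The total number of distinct part-sizes occurring with multiplicity at least 2 in all partitions of n (i.e. Σ over partitions λ of n of the number of distinct part-sizes i such that i occurs at least twice in λ) equals Σ_{i≥1} P(n − 2i), where P(m) denotes the number of partitions of m (and P(m) = 0 for m < 0). -/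
namespace Nat.Partition

theorem mul_le_of_le_count {n k i : ℕ} (μ : Partition n) (h : k ≤ μ.parts.count i) :
    k * i ≤ n := by
  obtain ⟨s, hs⟩ := Multiset.le_iff_exists_add.1 (Multiset.le_count_iff_replicate_le.1 h)
  have hsum := μ.parts_sum
  rw [hs, Multiset.sum_add, Multiset.sum_replicate, smul_eq_mul] at hsum
  omega

/-- Removing `k` copies of the part `i` identifies the partitions of `n` in which `i` occurs at
least `k` times with the partitions of `n - k * i`. -/
def countGeEquiv {n k i : ℕ} (hi : 0 < i) (h : k * i ≤ n) :
    {μ : Partition n // k ≤ μ.parts.count i} ≃ Partition (n - k * i) where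
  toFun μ :=
    { parts := μ.1.parts - Multiset.replicate k i
      parts_pos := fun hj => μ.1.parts_pos (Multiset.mem_of_le (Multiset.sub_le_self _ _) hj)
      parts_sum := by
        have hsum := congrArg Multiset.sum
          (Multiset.sub_add_cancel (Multiset.le_count_iff_replicate_le.1 μ.2))
        rw [Multiset.sum_add, Multiset.sum_replicate, smul_eq_mul, μ.1.parts_sum] at hsum
        omega }
  invFun ν :=
    ⟨{ parts := ν.parts + Multiset.replicate k i
       parts_pos := fun hj => (Multiset.mem_add.1 hj).elim ν.parts_pos
         fun hj => Multiset.eq_of_mem_replicate hj ▸ hi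
       parts_sum := by
        rw [Multiset.sum_add, Multiset.sum_replicate, smul_eq_mul, ν.parts_sum,
          Nat.sub_add_cancel h] },
      by simp⟩
  left_inv μ := Subtype.ext <| Partition.ext <|
    Multiset.sub_add_cancel (Multiset.le_count_iff_replicate_le.1 μ.2)
  right_inv _ := Partition.ext <| Multiset.add_sub_cancel_right

end Nat.Partition

/-- The total number of distinct part-sizes occurring with multiplicity at
least `2` in all partitions of `n` equals `Σ_{i ≥ 1} P(n - 2i)` where `P(m)` is
the number of partitions of `m` (the terms with `2i > n` vanish, so the sum is
taken over `1 ≤ i` with `2i ≤ n`). -/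
theorem statement18 (n : ℕ) :
    ∑ μ : Nat.Partition n, (μ.parts.toFinset.filter
        (fun i => 2 ≤ μ.parts.count i)).card
      = ∑ i ∈ (Finset.Icc 1 n).filter (fun i => 2 * i ≤ n),
          Fintype.card (Nat.Partition (n - 2 * i)) := by
  have repeated_eq (μ : Nat.Partition n) :
      μ.parts.toFinset.filter (fun i => 2 ≤ μ.parts.count i) =
        ((Finset.Icc 1 n).filter (fun i => 2 * i ≤ n)).filter
          (fun i => 2 ≤ μ.parts.count i) := by
    ext i
    simp only [Finset.mem_filter, Multiset.mem_toFinset, Finset.mem_Icc]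
    refine and_congr_left fun h => ?_
    have hmem : i ∈ μ.parts := Multiset.count_pos.1 (by omega)
    simp only [hmem, true_iff]
    exact ⟨⟨μ.parts_pos hmem, Nat.Partition.le_of_mem_parts hmem⟩, μ.mul_le_of_le_count h⟩
  simp_rw [repeated_eq]
  refine (Finset.sum_card_bipartiteAbove_eq_sum_card_bipartiteBelow
    (fun (μ : Nat.Partition n) i => 2 ≤ μ.parts.count i)).trans (Finset.sum_congr rfl fun i hi => ?_)
  simp only [Finset.mem_filter, Finset.mem_Icc] at hi
  rw [← Fintype.card_congr (Nat.Partition.countGeEquiv hi.1.1 hi.2), Fintype.card_subtype]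
  rfl
end
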